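/- arXiv:2508.17438 — 2 statements merged into one kernel-verified Lean document; each statement's English description precedes it below -/
import Mathlib

section
/- There exists a constant c > 0 such that for every integer k ≥ 2 and every k-connected finite simple graph G, any two longest cycles X and Y of G satisfy |V(X) ∩ V(Y)| ≥ c·k^(2/3). -/
open SimpleGraph

/-- `X` is a longest cycle in `G`. -/
def IsLongestCycle {V : Type*} (G : SimpleGraph V) {x : V} (X : G.Walk x x) : Prop :=
  X.IsCycle ∧ ∀ (y : V) (W : G.Walk y y), W.IsCycle → W.length ≤ X.length

/-- `G` is `k`-connected: it has more than `k` vertices and remains connected after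
deleting any set of fewer than `k` vertices. -/
def IsKConnected {V : Type*} [Fintype V] (G : SimpleGraph V) (k : ℕ) : Prop :=
  k < Fintype.card V ∧
    ∀ S : Finset V, S.card < k → ((⊤ : G.Subgraph).deleteVerts ↑S).coe.Connected


namespace LC
section geom
variable {V : Type} {G : SimpleGraph V}

/-- a walk from `a` to `b` with list of interior vertices `I` -/
def J (G : SimpleGraph V) (a b : V) (I : List V) : Prop := List.IsChain G.Adj (a :: (I ++ [b]))

lemma J.comp {a b c : V} {I I' : List V} (h : J G a b I) (h' : J G b c I') :
    J G a c (I ++ b :: I') := by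
  unfold J at *
  have : a :: ((I ++ b :: I') ++ [c]) = (a :: I) ++ b :: (I' ++ [c]) := by simp
  rw [this, List.isChain_split]
  exact ⟨by simpa using h, h'⟩

lemma J.rev {a b : V} {I : List V} (h : J G a b I) : J G b a I.reverse := by
  unfold J at *
  have h2 : List.IsChain G.Adj (a :: (I ++ [b])).reverse :=
    List.isChain_reverse.2 (h.imp fun _ _ h => h.symm)
  simpa using h2

/-- open slice -/
def sl (f : ℕ → V) (i j : ℕ) : List V := (List.range' i (j - i)).map f

lemma mem_sl {f : ℕ → V} {i j : ℕ} {v : V} : v ∈ sl f i j ↔ ∃ x, (i ≤ x ∧ x < j) ∧ f x = v := by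
  simp only [sl, List.mem_map, List.mem_range'_1]
  constructor
  · rintro ⟨x, hx, rfl⟩; exact ⟨x, by omega, rfl⟩
  · rintro ⟨x, hx, rfl⟩; exact ⟨x, by omega, rfl⟩

lemma length_sl {f : ℕ → V} {i j : ℕ} : (sl f i j).length = j - i := by simp [sl]

lemma nodup_sl {f : ℕ → V} {L i j : ℕ} (hf : ∀ x y, x < L → y < L → f x = f y → x = y)
    (hj : j ≤ L) : (sl f i j).Nodup := by
  refine List.Nodup.map_on ?_ List.nodup_range'
  intro x hx y hy h
  simp only [List.mem_range'_1] at hx hy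
  exact hf x y (by omega) (by omega) h

lemma sl_J_aux {f : ℕ → V} (i : ℕ) (d : ℕ) (h : ∀ x, i ≤ x → x < i + d + 1 → G.Adj (f x) (f (x+1))) :
    J G (f i) (f (i + d + 1)) (sl f (i+1) (i+d+1)) := by
  induction d with
  | zero => simp [J, sl]; exact h i (by omega) (by omega)
  | succ d ih =>
    have h1 := ih (fun x h1 h2 => h x h1 (by omega))
    have h2 : J G (f (i+d+1)) (f (i+(d+1)+1)) [] := by
      simp [J]; exact h _ (by omega) (by omega)
    have h3 := h1.comp h2
    convert h3 using 1
    simp only [sl]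
    rw [show i + (d+1) + 1 - (i+1) = (i+d+1-(i+1)) + 1 by omega, List.range'_concat]
    simp only [List.map_append, List.map_cons, List.map_nil]
    congr 3
    omega

lemma sl_J {f : ℕ → V} {L i j : ℕ} (h : ∀ x, x + 1 < L → G.Adj (f x) (f (x+1))) (hij : i < j)
    (hj : j < L) : J G (f i) (f j) (sl f (i+1) j) := by
  obtain ⟨d, rfl⟩ := Nat.exists_eq_add_of_lt hij
  exact sl_J_aux i d (fun x _ _ => h x (by omega))

/-- `f` parametrises a cycle on `[0,L)`. -/
structure Cyc (G : SimpleGraph V) (f : ℕ → V) (L : ℕ) : Prop where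
  pos : 0 < L
  inj : ∀ x y, x < L → y < L → f x = f y → x = y
  adj : ∀ x, x + 1 < L → G.Adj (f x) (f (x+1))
  close : G.Adj (f (L-1)) (f 0)

/-- every closed nodup list is of length at most `L` -/
def Bd (G : SimpleGraph V) (L : ℕ) : Prop :=
  ∀ a z, (a :: z).Nodup → J G a a z → (a :: z).length ≤ L

lemma Cyc.wrap {f : ℕ → V} {L i j : ℕ} (h : Cyc G f L) (hi : i ≤ j) (hj : j < L) :
    J G (f j) (f i) (sl f (j+1) L ++ sl f 0 i) := by
  have h0 : J G (f 0) (f 0) (sl f 1 L) := by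
    rcases Nat.lt_or_ge 1 L with h1 | h1
    · have h2 := sl_J (i := 0) (j := L - 1) h.adj (by omega) (by omega)
      have h3 : J G (f (L-1)) (f 0) [] := by simpa [J] using h.close
      convert h2.comp h3 using 1
      simp only [sl]
      rw [show L - 1 = (L - 1 - (0 + 1)) + 1 by omega, List.range'_concat]
      simp only [List.map_append, List.map_cons, List.map_nil]
      congr 3
      omega
    · have : L = 1 := by have := h.pos; omega
      subst this
      have := h.close
      simp at this
  unfold J at h0 ⊢
  -- rotate
  have e1 : f j :: ((sl f (j+1) L ++ sl f 0 i) ++ [f i]) = sl f j L ++ sl f 0 (i+1) := by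
    have a1 : sl f j L = f j :: sl f (j+1) L := by
      simp only [sl]
      rw [show L - j = (L - (j+1)) + 1 by omega, List.range'_succ]; simp
    have a2 : sl f 0 (i+1) = sl f 0 i ++ [f i] := by
      simp only [sl]
      rw [show i + 1 - 0 = (i - 0) + 1 by omega, List.range'_concat]; simp
    rw [a1, a2]; simp
  rw [e1]
  have hpre : List.IsChain G.Adj (sl f j L ++ [f 0]) := by
    have : f 0 :: (sl f 1 L ++ [f 0]) = sl f 0 j ++ (sl f j L ++ [f 0]) := by
      have : f 0 :: sl f 1 L = sl f 0 j ++ sl f j L := by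
        have a1 : sl f 0 L = f 0 :: sl f 1 L := by
          simp only [sl]
          rw [show L - 0 = (L - 1) + 1 by omega, List.range'_succ]; simp
        rw [← a1]
        simp only [sl]
        rw [← List.map_append]
        congr 1
        have := List.range'_append_1 (s := 0) (m := j) (n := L - j)
        rw [show L - 0 = j + (L - j) by omega, ← this]; simp
      rw [← List.append_assoc, ← this]; simp
    rw [this] at h0
    exact h0.right_of_append
  have hsuf : List.IsChain G.Adj (sl f 0 (i+1)) := by
    rcases Nat.eq_zero_or_pos i with rfl | hi0
    · simp [sl]
    · have := sl_J (i := 0) (j := i) h.adj (by omega) (by omega)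
      unfold J at this
      convert this using 1
      simp only [sl]
      rw [show i + 1 - 0 = (i - (0+1)) + 1 + 1 by omega, List.range'_concat, List.range'_succ]
      simp
      congr 1; omega
  have a1 : sl f 0 (i+1) = f 0 :: sl f 1 (i+1) := by
    simp only [sl]
    rw [show i + 1 - 0 = (i+1-1) + 1 by omega, List.range'_succ]; simp
  rw [a1] at hsuf ⊢
  rw [List.isChain_split]
  exact ⟨hpre, hsuf⟩

end geom
end LC

namespace LC
section exch
variable {V : Type} {G : SimpleGraph V}

/-- bridge lists: nodup and avoiding `f` on `[0,L)` -/
def Off (f : ℕ → V) (L : ℕ) (I : List V) : Prop := I.Nodup ∧ ∀ v ∈ I, ∀ x < L, f x ≠ v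

lemma Off.append {f : ℕ → V} {L : ℕ} {I I' : List V} (h : Off f L I) (h' : Off f L I')
    (hd : ∀ v ∈ I, v ∉ I') : Off f L (I ++ I') := by
  refine ⟨List.nodup_append.2 ⟨h.1, h'.1, fun a ha b hb e => hd a ha (e ▸ hb)⟩, ?_⟩
  intro v hv
  rcases List.mem_append.1 hv with hv | hv
  · exact h.2 v hv
  · exact h'.2 v hv

def Gd (b L : ℕ) (K : List ℕ) : Prop := K.Nodup ∧ ∀ x ∈ K, b ≤ x ∧ x < L

lemma Gd.cons {b i L : ℕ} {K : List ℕ} (h : Gd b L K) (hi : i < b) (hL : i < L) :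
    Gd i L (i :: K) := by
  refine ⟨List.nodup_cons.2 ⟨fun hx => ?_, h.1⟩, fun x hx => ?_⟩
  · have := h.2 _ hx; omega
  · rcases List.mem_cons.1 hx with rfl | hx
    · omega
    · have := h.2 _ hx; omega

lemma Gd.app {b i j L : ℕ} {K : List ℕ} (h : Gd b L K) (hi : i ≤ j) (hj : j ≤ b) (hL : j ≤ L) :
    Gd i L (List.range' i (j - i) ++ K) := by
  refine ⟨List.nodup_append.2 ⟨List.nodup_range', h.1, fun x hx y hy e => ?_⟩, fun x hx => ?_⟩
  · have := h.2 _ hy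
    simp at hx; omega
  · rcases List.mem_append.1 hx with hx | hx
    · simp at hx; omega
    · have := h.2 _ hx; omega

lemma Gd.tl {i L : ℕ} : Gd i L (List.range' i (L - i)) := by
  refine ⟨List.nodup_range', fun x hx => ?_⟩
  simp at hx; omega

lemma nodup_of {f : ℕ → V} {L : ℕ} {z B : List V} {K : List ℕ}
    (hf : ∀ x y, x < L → y < L → f x = f y → x = y)
    (hp : z.Perm (K.map f ++ B)) (hKK : Gd 0 L K) (hB : Off f L B) :
    z.Nodup := by
  have hK := hKK.1
  have hK' : ∀ x ∈ K, x < L := fun x hx => (hKK.2 x hx).2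
  rw [hp.nodup_iff, List.nodup_append]
  refine ⟨List.Nodup.map_on (fun x hx y hy h => hf x y (hK' x hx) (hK' y hy) h) hK, hB.1, ?_⟩
  intro a ha b hb e
  obtain ⟨x, hx, rfl⟩ := List.mem_map.1 ha
  exact hB.2 b hb x (hK' x hx) e

lemma ex1 {f : ℕ → V} {L i j : ℕ} (h : Cyc G f L) (hb : Bd G L) (hij : i < j) (hj : j < L)
    {I : List V} (hI : Off f L I) (hJ : J G (f i) (f j) I) : I.length + 1 ≤ j - i := by
  classical
  have hc := hJ.comp (h.wrap hij.le hj)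
  have := hb _ _ ?_ hc
  · simp [length_sl] at this; omega
  · refine nodup_of (K := List.range' 0 (i - 0) ++ i :: j :: List.range' (j+1) (L - (j+1))) (B := I)
      h.inj ?_ ?_ hI
    · rw [List.perm_iff_count]; intro v
      simp [sl, List.count_append, List.count_cons]; omega
    · exact (((Gd.tl).cons (by omega) (by omega)).cons
      (by omega) (by omega)).app (by omega) (by omega) (by omega)

lemma ex2 {f : ℕ → V} {L i1 i2 i3 i4 : ℕ} (h : Cyc G f L) (hb : Bd G L) (h12 : i1 < i2)
    (h23 : i2 < i3) (h34 : i3 < i4) (h4 : i4 < L)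
    {I I' : List V} (hI : Off f L (I ++ I'))
    (hJ : J G (f i1) (f i3) I) (hJ' : J G (f i2) (f i4) I') :
    I.length + I'.length + 2 ≤ (i2 - i1) + (i4 - i3) := by
  classical
  have hc := hJ.comp ((sl_J h.adj h23 (by omega)).rev.comp (hJ'.comp (h.wrap (i := i1) (by omega) h4)))
  have := hb _ _ ?_ hc
  · simp [length_sl] at this; omega
  · refine nodup_of (K := List.range' 0 (i1 - 0) ++ i1 :: i2 :: (List.range' (i2+1) (i3 - (i2+1)) ++
      i3 :: i4 :: List.range' (i4+1) (L - (i4+1)))) (B := I ++ I') h.inj ?_ ?_ hI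
    · rw [List.perm_iff_count]; intro v
      simp [sl, List.count_append, List.count_cons]; omega
    · exact ((((((Gd.tl).cons (by omega) (by omega)).cons
      (by omega) (by omega)).app (by omega) (by omega) (by omega)).cons (by omega) (by omega)).cons
      (by omega) (by omega)).app (by omega) (by omega) (by omega)

lemma ex3 {f : ℕ → V} {L i1 i2 i3 i4 i5 i6 i7 i8 : ℕ} (h : Cyc G f L) (hb : Bd G L) (h12 : i1 < i2)
    (h23 : i2 < i3) (h34 : i3 < i4) (h45 : i4 < i5) (h56 : i5 < i6) (h67 : i6 < i7) (h78 : i7 < i8)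
    (h8 : i8 < L)
    {I1 I2 I3 I4 : List V} (hI : Off f L (I1 ++ (I2 ++ (I3 ++ I4))))
    (hJ1 : J G (f i1) (f i6) I1) (hJ2 : J G (f i7) (f i4) I2)
    (hJ3 : J G (f i5) (f i2) I3) (hJ4 : J G (f i3) (f i8) I4) :
    I1.length + I2.length + I3.length + I4.length + 4 ≤
      (i2 - i1) + (i4 - i3) + (i6 - i5) + (i8 - i7) := by
  classical
  have hc := hJ1.comp ((sl_J h.adj h67 (by omega)).comp (hJ2.comp ((sl_J h.adj h45 (by omega)).comp
    (hJ3.comp ((sl_J h.adj h23 (by omega)).comp (hJ4.comp (h.wrap (i := i1) (by omega) h8)))))))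
  have := hb _ _ ?_ hc
  · simp [length_sl] at this; omega
  · refine nodup_of (K := List.range' 0 (i1 - 0) ++ i1 :: i2 :: (List.range' (i2+1) (i3 - (i2+1)) ++
      i3 :: i4 :: (List.range' (i4+1) (i5 - (i4+1)) ++ i5 :: i6 ::
      (List.range' (i6+1) (i7 - (i6+1)) ++ i7 :: i8 :: List.range' (i8+1) (L - (i8+1))))))
      (B := I1 ++ (I2 ++ (I3 ++ I4))) h.inj ?_ ?_ hI
    · rw [List.perm_iff_count]; intro v
      simp [sl, List.count_append, List.count_cons]; omega
    · exact ((((((((((((Gd.tl).cons (by omega) (by omega)).cons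
      (by omega) (by omega)).app (by omega) (by omega) (by omega)).cons (by omega) (by omega)).cons
      (by omega) (by omega)).app (by omega) (by omega) (by omega)).cons (by omega) (by omega)).cons
      (by omega) (by omega)).app (by omega) (by omega) (by omega)).cons (by omega) (by omega)).cons
      (by omega) (by omega)).app (by omega) (by omega) (by omega)

end exch
end LC

namespace LC
section sys
variable {V : Type} {G : SimpleGraph V} {ι : Type}

structure Sys (G : SimpleGraph V) (f g : ℕ → V) (L : ℕ) (a b : ι → ℕ) (σ τ : ℕ → ℕ)
    (I : ι → List V) : Prop where
  cf : Cyc G f L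
  cg : Cyc G g L
  bd : Bd G L
  ha : ∀ w, a w < L
  hb : ∀ w, b w < L
  hJ : ∀ w, J G (f (a w)) (g (b w)) (I w)
  nd : ∀ w, (I w).Nodup
  dis : ∀ w w', w ≠ w' → ∀ v ∈ I w, v ∉ I w'
  offf : ∀ w, ∀ v ∈ I w, ∀ x < L, f x ≠ v
  offg : ∀ w, ∀ v ∈ I w, ∀ x < L, g x ≠ v
  ainj : ∀ w w', a w = a w' → w = w'
  binj : ∀ w w', b w = b w' → w = w'
  sm : Monotone σ
  tm : Monotone τ
  segf : ∀ w w', σ (a w) = σ (a w') → ∀ x, a w ≤ x → x ≤ a w' → ∀ y < L, g y ≠ f x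
  segg : ∀ w w', τ (b w) = τ (b w') → ∀ x, b w ≤ x → x ≤ b w' → ∀ y < L, f y ≠ g x

variable {f g : ℕ → V} {L : ℕ} {a b : ι → ℕ} {σ τ : ℕ → ℕ} {I : ι → List V}

lemma Sys.swap (h : Sys G f g L a b σ τ I) : Sys G g f L b a τ σ (fun w => (I w).reverse) where
  cf := h.cg
  cg := h.cf
  bd := h.bd
  ha := h.hb
  hb := h.ha
  hJ := fun w => (h.hJ w).rev
  nd := fun w => List.nodup_reverse.2 (h.nd w)
  dis := fun w w' e v hv hv' => h.dis w w' e v (List.mem_reverse.1 hv) (List.mem_reverse.1 hv')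
  offf := fun w v hv => h.offg w v (List.mem_reverse.1 hv)
  offg := fun w v hv => h.offf w v (List.mem_reverse.1 hv)
  ainj := h.binj
  binj := h.ainj
  sm := h.tm
  tm := h.sm
  segf := h.segg
  segg := h.segf

/-- `B` is a bridge between `w` and `w'` -/
structure Br (G : SimpleGraph V) (f g : ℕ → V) (L : ℕ) (a b : ι → ℕ) (τ : ℕ → ℕ)
    (I : ι → List V) (w w' : ι) (B : List V) : Prop where
  j : J G (f (a w)) (f (a w')) B
  off : Off f L B
  len : (b w - b w') + (b w' - b w) + 1 ≤ B.length
  mem : ∀ v ∈ B, v ∈ I w ∨ v ∈ I w' ∨ ∃ y < L, τ y = τ (b w) ∧ g y = v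

lemma Br.symm {w w' : ι} {B : List V} (h : Br G f g L a b τ I w w' B)
    (ht : τ (b w) = τ (b w')) : Br G f g L a b τ I w' w B.reverse where
  j := h.j.rev
  off := ⟨List.nodup_reverse.2 h.off.1, fun v hv => h.off.2 v (List.mem_reverse.1 hv)⟩
  len := by have := h.len; simp; omega
  mem := by
    intro v hv
    have := h.mem v (List.mem_reverse.1 hv)
    rw [← ht]; tauto

lemma Sys.bridge_aux (h : Sys G f g L a b σ τ I) {w w' : ι} (hlt : b w < b w')
    (ht : τ (b w) = τ (b w')) : ∃ B, Br G f g L a b τ I w w' B := by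
  have hlt' := h.hb w'
  have hne : w ≠ w' := by rintro rfl; omega
  refine ⟨_, (h.hJ w).comp ((sl_J h.cg.adj hlt (h.hb w')).comp (h.hJ w').rev), ?_, ?_, ?_⟩
  · have e : I w ++ g (b w) :: (sl g (b w + 1) (b w') ++ g (b w') :: (I w').reverse) =
        I w ++ (sl g (b w) (b w' + 1) ++ (I w').reverse) := by
      have a1 : sl g (b w) (b w' + 1) = g (b w) :: (sl g (b w + 1) (b w') ++ [g (b w')]) := by
        simp only [sl]
        rw [show b w' + 1 - b w = (b w' - (b w+1)) + 1 + 1 by omega, List.range'_concat,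
          List.range'_succ]
        simp; congr 1; omega
      rw [a1]; simp
    rw [e]
    refine Off.append ⟨h.nd w, h.offf w⟩ (Off.append ?_ ⟨List.nodup_reverse.2 (h.nd w'), ?_⟩ ?_) ?_
    · refine ⟨nodup_sl h.cg.inj (by omega), ?_⟩
      intro v hv x hx
      obtain ⟨y, hy, rfl⟩ := mem_sl.1 hv
      exact h.segg w w' ht y (by omega) (by omega) x hx
    · intro v hv; exact h.offf w' v (List.mem_reverse.1 hv)
    · intro v hv hv'
      obtain ⟨y, hy, rfl⟩ := mem_sl.1 hv
      exact h.offg w' _ (List.mem_reverse.1 hv') y (by omega) rfl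
    · intro v hv hv'
      rcases List.mem_append.1 hv' with hv' | hv'
      · obtain ⟨y, hy, rfl⟩ := mem_sl.1 hv'
        exact h.offg w _ hv y (by omega) rfl
      · exact h.dis w w' hne v hv (List.mem_reverse.1 hv')
  · simp [length_sl]; omega
  · intro v hv
    simp only [List.mem_append, List.mem_cons, mem_sl, List.mem_reverse] at hv
    rcases hv with hv | rfl | ⟨y, hy, rfl⟩ | rfl | hv
    · exact .inl hv
    · exact .inr (.inr ⟨_, h.hb w, rfl, rfl⟩)
    · refine .inr (.inr ⟨y, by omega, ?_, rfl⟩)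
      have := h.tm (show b w ≤ y by omega)
      have := h.tm (show y ≤ b w' by omega)
      omega
    · exact .inr (.inr ⟨_, h.hb w', ht.symm, rfl⟩)
    · exact .inr (.inl hv)

lemma Sys.bridge (h : Sys G f g L a b σ τ I) {w w' : ι} (hne : w ≠ w')
    (ht : τ (b w) = τ (b w')) : ∃ B, Br G f g L a b τ I w w' B := by
  rcases Nat.lt_trichotomy (b w) (b w') with h1 | h1 | h1
  · exact h.bridge_aux h1 ht
  · exact absurd (h.binj _ _ h1) hne
  · obtain ⟨B, hB⟩ := h.bridge_aux h1 ht.symm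
    exact ⟨_, hB.symm ht.symm⟩

lemma Sys.br_dis (h : Sys G f g L a b σ τ I) {w w' u u' : ι} {B B' : List V}
    (hB : Br G f g L a b τ I w w' B) (hB' : Br G f g L a b τ I u u' B')
    (hw : τ (b w) = τ (b w')) (hu : τ (b u) = τ (b u')) (hne : τ (b w) ≠ τ (b u)) :
    ∀ v ∈ B, v ∉ B' := by
  have n1 : w ≠ u := by rintro rfl; exact hne rfl
  have n2 : w ≠ u' := by rintro rfl; exact hne hu.symm
  have n3 : w' ≠ u := by rintro rfl; exact hne hw
  have n4 : w' ≠ u' := by rintro rfl; exact hne (hw.trans hu.symm)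
  intro v hv hv'
  rcases hB.mem v hv with h1 | h1 | ⟨y, hy, hy', rfl⟩ <;>
  rcases hB'.mem _ hv' with h2 | h2 | ⟨z, hz, hz', h2⟩
  · exact h.dis _ _ n1 v h1 h2
  · exact h.dis _ _ n2 v h1 h2
  · exact h.offg _ _ h1 z hz h2
  · exact h.dis _ _ n3 v h1 h2
  · exact h.dis _ _ n4 v h1 h2
  · exact h.offg _ _ h1 z hz h2
  · exact h.offg _ _ h2 y hy rfl
  · exact h.offg _ _ h2 y hy rfl
  · have := h.cg.inj _ _ hz hy h2
    subst this
    exact hne (hy'.symm.trans hz')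

lemma Sys.g1 (h : Sys G f g L a b σ τ I) {w w' : ι} (hlt : a w < a w')
    (ht : τ (b w) = τ (b w')) :
    (b w - b w') + (b w' - b w) < a w' - a w := by
  obtain ⟨B, hB⟩ := h.bridge (w := w) (w' := w') (by rintro rfl; omega) ht
  have := ex1 h.cf h.bd hlt (h.ha w') hB.off hB.j
  have := hB.len
  omega

lemma Sys.g2 (h : Sys G f g L a b σ τ I) {w1 w2 w3 w4 : ι} (h12 : a w1 < a w2)
    (h23 : a w2 < a w3) (h34 : a w3 < a w4)
    (t13 : τ (b w1) = τ (b w3)) (t24 : τ (b w2) = τ (b w4)) (hne : τ (b w1) ≠ τ (b w2)) :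
    (b w1 - b w3) + (b w3 - b w1) + ((b w2 - b w4) + (b w4 - b w2)) <
      (a w2 - a w1) + (a w4 - a w3) := by
  obtain ⟨B, hB⟩ := h.bridge (w := w1) (w' := w3) (by rintro rfl; omega) t13
  obtain ⟨B', hB'⟩ := h.bridge (w := w2) (w' := w4) (by rintro rfl; omega) t24
  have := ex2 h.cf h.bd h12 h23 h34 (h.ha w4)
    (hB.off.append hB'.off (h.br_dis hB hB' t13 t24 hne)) hB.j hB'.j
  have := hB.len
  have := hB'.len
  omega

lemma Sys.g3 (h : Sys G f g L a b σ τ I) {w1 w2 w3 w4 w5 w6 w7 w8 : ι} (h12 : a w1 < a w2)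
    (h23 : a w2 < a w3) (h34 : a w3 < a w4) (h45 : a w4 < a w5) (h56 : a w5 < a w6)
    (h67 : a w6 < a w7) (h78 : a w7 < a w8)
    (t16 : τ (b w1) = τ (b w6)) (t74 : τ (b w7) = τ (b w4)) (t52 : τ (b w5) = τ (b w2))
    (t38 : τ (b w3) = τ (b w8)) (n1 : τ (b w1) ≠ τ (b w7)) (n2 : τ (b w1) ≠ τ (b w5))
    (n3 : τ (b w1) ≠ τ (b w3)) (n4 : τ (b w7) ≠ τ (b w5)) (n5 : τ (b w7) ≠ τ (b w3))
    (n6 : τ (b w5) ≠ τ (b w3)) :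
    (b w1 - b w6) + (b w6 - b w1) + ((b w7 - b w4) + (b w4 - b w7)) +
    ((b w5 - b w2) + (b w2 - b w5)) + ((b w3 - b w8) + (b w8 - b w3)) <
      (a w2 - a w1) + (a w4 - a w3) + (a w6 - a w5) + (a w8 - a w7) := by
  obtain ⟨B1, hB1⟩ := h.bridge (w := w1) (w' := w6) (by rintro rfl; omega) t16
  obtain ⟨B2, hB2⟩ := h.bridge (w := w7) (w' := w4) (by rintro rfl; omega) t74
  obtain ⟨B3, hB3⟩ := h.bridge (w := w5) (w' := w2) (by rintro rfl; omega) t52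
  obtain ⟨B4, hB4⟩ := h.bridge (w := w3) (w' := w8) (by rintro rfl; omega) t38
  have o34 := hB3.off.append hB4.off (h.br_dis hB3 hB4 t52 t38 n6)
  have o234 := hB2.off.append o34 (by
    intro v hv hv'
    rcases List.mem_append.1 hv' with h' | h'
    · exact h.br_dis hB2 hB3 t74 t52 n4 v hv h'
    · exact h.br_dis hB2 hB4 t74 t38 n5 v hv h')
  have o1234 := hB1.off.append o234 (by
    intro v hv hv'
    rcases List.mem_append.1 hv' with h' | h'
    · exact h.br_dis hB1 hB2 t16 t74 n1 v hv h'
    rcases List.mem_append.1 h' with h' | h'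
    · exact h.br_dis hB1 hB3 t16 t52 n2 v hv h'
    · exact h.br_dis hB1 hB4 t16 t38 n3 v hv h')
  have := ex3 h.cf h.bd h12 h23 h34 h45 h56 h67 h78 (h.ha w8) o1234 hB1.j hB2.j hB3.j hB4.j
  have := hB1.len
  have := hB2.len
  have := hB3.len
  have := hB4.len
  omega

end sys
end LC

namespace LC
section comb

lemma fat_count (n : ℕ) (F : Finset (ℕ × ℕ)) (hF : ∀ p r, (p, r) ∈ F → p < r ∧ r < n)
    (hx : ∀ p r p' r', (p, r) ∈ F → (p', r') ∈ F → p < p' → p' < r → r < r' → False) :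
    F.card ≤ 2 * n := by
  classical
  let F1 := F.filter (fun e => ∀ r', (e.1, r') ∈ F → r' ≤ e.2)
  let F2 := F.filter (fun e => ∀ p', (p', e.2) ∈ F → e.1 ≤ p')
  have h1 : F1.card ≤ (Finset.range n).card := by
    refine Finset.card_le_card_of_injOn Prod.fst ?_ ?_
    · rintro ⟨p, r⟩ he
      simp only [F1, Finset.coe_filter, Set.mem_ofPred_eq] at he
      have := hF p r he.1
      simp; omega
    · rintro ⟨p, r⟩ he ⟨p', r'⟩ he' h
      simp only [F1, Finset.coe_filter, Set.mem_ofPred_eq] at he he'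
      simp only at h
      subst h
      have := he.2 r' he'.1
      have := he'.2 r he.1
      simp; omega
  have h2 : F2.card ≤ (Finset.range n).card := by
    refine Finset.card_le_card_of_injOn Prod.snd ?_ ?_
    · rintro ⟨p, r⟩ he
      simp only [F2, Finset.coe_filter, Set.mem_ofPred_eq] at he
      have := hF p r he.1
      simp; omega
    · rintro ⟨p, r⟩ he ⟨p', r'⟩ he' h
      simp only [F2, Finset.coe_filter, Set.mem_ofPred_eq] at he he'
      simp only at h
      subst h
      have := he.2 p' he'.1
      have := he'.2 p he.1
      simp; omega
  have h3 : F ⊆ F1 ∪ F2 := by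
    rintro ⟨p, r⟩ he
    by_contra hc
    simp only [Finset.mem_union, not_or, F1, F2, Finset.mem_filter, he, true_and, not_forall,
      not_le] at hc
    obtain ⟨⟨r', h1, h2⟩, ⟨p', h3, h4⟩⟩ := hc
    exact hx p' r p r' h3 h1 h4 (hF p r he).1 h2
  have h4 := (Finset.card_le_card h3).trans (Finset.card_union_le _ _)
  simp only [Finset.card_range] at h1 h2
  omega

lemma edge_count (n : ℕ) (E : Finset (ℕ × ℕ)) (hE : ∀ p q, (p, q) ∈ E → p < n ∧ q < n)
    (F : Finset (ℕ × ℕ)) (hF : F.card ≤ 2 * n)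
    (hfat : ∀ p r, p < r → r < n →
      5 ≤ ((Finset.range n).filter (fun q => (p, q) ∈ E ∧ (r, q) ∈ E)).card → (p, r) ∈ F) :
    E.card ≤ n ^ 2 ∧ E.card ^ 2 ≤ 9 * n ^ 3 := by
  classical
  let N : ℕ → ℕ → ℕ := fun p r =>
    ((Finset.range n).filter (fun q => (p, q) ∈ E ∧ (r, q) ∈ E)).card
  let d : ℕ → ℕ := fun q => ((Finset.range n).filter (fun p => (p, q) ∈ E)).card
  have hEs : E ⊆ Finset.range n ×ˢ Finset.range n := by
    rintro ⟨p, q⟩ h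
    simpa using hE p q h
  have hn2 : E.card ≤ n ^ 2 := by
    have := Finset.card_le_card hEs
    simp at this
    nlinarith
  refine ⟨hn2, ?_⟩
  have hEf : E = (Finset.range n ×ˢ Finset.range n).filter (fun e => e ∈ E) := by
    ext e; simp only [Finset.mem_filter]; exact ⟨fun h => ⟨hEs h, h⟩, fun h => h.2⟩
  have hEc : E.card = ∑ p ∈ Finset.range n, ∑ q ∈ Finset.range n, if (p, q) ∈ E then 1 else 0 := by
    rw [← Finset.sum_product' (f := fun p q => if (p, q) ∈ E then 1 else 0)]
    conv_lhs => rw [hEf]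
    rw [Finset.card_filter]
  have hd : ∀ q, d q = ∑ p ∈ Finset.range n, if (p, q) ∈ E then 1 else 0 := by
    intro q; simp only [d, Finset.card_filter]
  have hEd : E.card = ∑ q ∈ Finset.range n, d q := by
    rw [hEc, Finset.sum_comm]; simp only [hd]
  have hN : ∀ p r, N p r = ∑ q ∈ Finset.range n,
      (if (p, q) ∈ E then 1 else 0) * (if (r, q) ∈ E then 1 else 0) := by
    intro p r
    simp only [N, Finset.card_filter]
    refine Finset.sum_congr rfl fun q _ => ?_
    by_cases h1 : (p, q) ∈ E <;> by_cases h2 : (r, q) ∈ E <;> simp [h1, h2]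
  have hdd : ∑ q ∈ Finset.range n, d q ^ 2 =
      ∑ p ∈ Finset.range n, ∑ r ∈ Finset.range n, N p r := by
    simp only [hN]
    have : ∀ q, d q ^ 2 = ∑ p ∈ Finset.range n, ∑ r ∈ Finset.range n,
        (if (p, q) ∈ E then 1 else 0) * (if (r, q) ∈ E then 1 else 0) := by
      intro q
      rw [sq, hd, Finset.sum_mul_sum]
    simp only [this]
    rw [Finset.sum_comm]
    refine Finset.sum_congr rfl fun p _ => ?_
    rw [Finset.sum_comm]
  have hNn : ∀ p r, N p r ≤ n := by
    intro p r
    have := Finset.card_filter_le (Finset.range n) (fun q => (p, q) ∈ E ∧ (r, q) ∈ E)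
    simpa using this
  have hNs : ∀ p r, N p r = N r p := by
    intro p r
    simp only [N, and_comm]
  have hbd : ∀ p ∈ Finset.range n, ∀ r ∈ Finset.range n, N p r ≤
      4 + n * (if (p, r) ∈ F then 1 else 0) + n * (if (r, p) ∈ F then 1 else 0) +
        (if r = p then N p p else 0) := by
    intro p hp r hr
    simp only [Finset.mem_range] at hp hr
    rcases lt_trichotomy p r with h | h | h
    · by_cases h5 : 5 ≤ N p r
      · rw [if_pos (hfat p r h hr h5)]
        have := hNn p r
        omega
      · omega
    · subst h; simp
    · by_cases h5 : 5 ≤ N p r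
      · rw [hNs] at h5
        rw [if_pos (hfat r p h hp h5)]
        have := hNn p r
        omega
      · omega
  have hF1 : ∑ p ∈ Finset.range n, ∑ r ∈ Finset.range n, (if (p, r) ∈ F then 1 else 0) ≤ 2 * n := by
    rw [← Finset.sum_product' (f := fun p r => if (p, r) ∈ F then 1 else 0)]
    simp only [Prod.mk.eta]
    rw [← Finset.card_filter]
    refine le_trans (Finset.card_le_card ?_) hF
    intro e he
    exact (Finset.mem_filter.1 he).2
  have hF2 : ∑ p ∈ Finset.range n, ∑ r ∈ Finset.range n, (if (r, p) ∈ F then 1 else 0) ≤ 2 * n := by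
    rw [Finset.sum_comm]; exact hF1
  have hdiag : ∑ p ∈ Finset.range n, N p p = E.card := by
    rw [hEc]
    refine Finset.sum_congr rfl fun p _ => ?_
    rw [hN]
    refine Finset.sum_congr rfl fun q _ => ?_
    by_cases h1 : (p, q) ∈ E <;> simp [h1]
  have hS : ∑ q ∈ Finset.range n, d q ^ 2 ≤ 8 * n ^ 2 + E.card := by
    rw [hdd]
    refine (Finset.sum_le_sum fun p hp => Finset.sum_le_sum fun r hr => hbd p hp r hr).trans ?_
    simp only [Finset.sum_add_distrib, ← Finset.mul_sum]
    have h4 : ∑ p ∈ Finset.range n, ∑ r ∈ Finset.range n, (if r = p then N p p else 0) = E.card := by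
      rw [← hdiag]
      refine Finset.sum_congr rfl fun p hp => ?_
      rw [Finset.sum_ite_eq' (Finset.range n) p (fun _ => N p p), if_pos hp]
    rw [h4]
    simp only [Finset.sum_const, Finset.card_range, smul_eq_mul]
    nlinarith [Nat.mul_le_mul_left n hF1, Nat.mul_le_mul_left n hF2]
  have hC : (∑ q ∈ Finset.range n, d q) ^ 2 ≤ n * ∑ q ∈ Finset.range n, d q ^ 2 := by
    have := sq_sum_le_card_mul_sum_sq (s := Finset.range n) (f := d)
    simpa using this
  rw [← hEd] at hC
  calc E.card ^ 2 ≤ _ := hC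
    _ ≤ n * (9 * n ^ 2) := Nat.mul_le_mul_left n (by omega)
    _ = 9 * n ^ 3 := by ring

variable {V : Type} {G : SimpleGraph V} {ι : Type}
variable {f g : ℕ → V} {L : ℕ} {a b : ι → ℕ} {σ τ : ℕ → ℕ} {I : ι → List V}

lemma Sys.st_inj (h : Sys G f g L a b σ τ I) {w w' : ι} (hs : σ (a w) = σ (a w'))
    (ht : τ (b w) = τ (b w')) : w = w' := by
  by_contra hne
  have h1 : a w ≠ a w' := fun e => hne (h.ainj _ _ e)
  have h2 : b w ≠ b w' := fun e => hne (h.binj _ _ e)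
  rcases lt_or_gt_of_ne h1 with h1 | h1 <;> rcases lt_or_gt_of_ne h2 with h2 | h2
  · have := h.g1 h1 ht
    have := h.swap.g1 h2 hs
    omega
  · have := h.g1 h1 ht
    have := h.swap.g1 h2 hs.symm
    omega
  · have := h.g1 h1 ht.symm
    have := h.swap.g1 h2 hs
    omega
  · have := h.g1 h1 ht.symm
    have := h.swap.g1 h2 hs.symm
    omega

lemma Sys.lta (h : Sys G f g L a b σ τ I) {w w' : ι} (hs : σ (a w) < σ (a w')) : a w < a w' := by
  by_contra hc
  have := h.sm (not_lt.1 hc)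
  omega

lemma Sys.ltb (h : Sys G f g L a b σ τ I) {w w' : ι} (hs : τ (b w) < τ (b w')) : b w < b w' := by
  by_contra hc
  have := h.tm (not_lt.1 hc)
  omega

/-- `w, w'` lie over `P`, `R` with common value `Q` -/
def Cm (a b : ι → ℕ) (σ τ : ℕ → ℕ) (P R Q : ℕ) (w w' : ι) : Prop :=
  σ (a w) = P ∧ τ (b w) = Q ∧ σ (a w') = R ∧ τ (b w') = Q

/-- the twin configuration -/
structure Twin (a b : ι → ℕ) (σ τ : ℕ → ℕ) (P R Q Q' : ℕ) (x x' y y' : ι) : Prop where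
  c : Cm a b σ τ P R Q x y
  c' : Cm a b σ τ P R Q' x' y'
  ne : Q ≠ Q'
  l1 : a x < a x'
  l2 : a y' < a y
  ineq : (a x' - a x) + (a y - a y') < (b x - b y) + (b y - b x) + ((b x' - b y') + (b y' - b x'))

lemma Sys.twin_aux (h : Sys G f g L a b σ τ I) {P R Q Q' : ℕ} (hPR : P < R) {x x' y y' : ι}
    (c : Cm a b σ τ P R Q x y) (c' : Cm a b σ τ P R Q' x' y') (hQ : Q < Q')
    (hcl : b x < b y ↔ b x' < b y') :
    (a x - a x') + (a x' - a x) + ((a y - a y') + (a y' - a y)) <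
      (b x - b y) + (b y - b x) + ((b x' - b y') + (b y' - b x')) := by
  obtain ⟨c1, c2, c3, c4⟩ := c
  obtain ⟨d1, d2, d3, d4⟩ := c'
  by_cases hb : b x < b y
  · have hb' := hcl.1 hb
    have := h.swap.g2 (w1 := x) (w2 := y) (w3 := x') (w4 := y') hb
      (h.ltb (by omega)) hb' (by omega) (by omega) (by omega)
    omega
  · have hb' : ¬ b x' < b y' := fun e => hb (hcl.2 e)
    have e1 : b x ≠ b y := by
      intro e
      have := h.binj _ _ e
      subst this; omega
    have e2 : b x' ≠ b y' := by
      intro e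
      have := h.binj _ _ e
      subst this; omega
    have := h.swap.g2 (w1 := y) (w2 := x) (w3 := y') (w4 := x') (by omega)
      (h.ltb (by omega)) (by omega) (by omega) (by omega) (by omega)
    omega

lemma Sys.twin (h : Sys G f g L a b σ τ I) {P R : ℕ} (hPR : P < R) (T : Finset ℕ)
    (hT : 3 ≤ T.card) (hc : ∀ Q ∈ T, ∃ w w', Cm a b σ τ P R Q w w') :
    ∃ Q ∈ T, ∃ Q' ∈ T, ∃ x x' y y', Twin a b σ τ P R Q Q' x x' y y' := by
  classical
  have hne0 : Nonempty ι := by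
    obtain ⟨Q, hQ⟩ := Finset.card_pos.1 (show 0 < T.card by omega)
    obtain ⟨w, _⟩ := hc Q hQ
    exact ⟨w⟩
  choose! u v huv using hc
  obtain ⟨Q, hQ, Q', hQ', hne, hcl⟩ := Finset.exists_ne_map_eq_of_card_lt_of_maps_to
    (s := T) (t := (Finset.univ : Finset Bool)) (by simp; omega)
    (f := fun Q => decide (b (u Q) < b (v Q))) (fun _ _ => Finset.mem_coe.2 (Finset.mem_univ _))
  have hcl' : b (u Q) < b (v Q) ↔ b (u Q') < b (v Q') := by simpa using hcl
  clear hcl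
  wlog hlt : Q < Q' generalizing Q Q'
  · exact this Q' hQ' Q hQ hne.symm hcl'.symm (by omega)
  have c := huv Q hQ
  have c' := huv Q' hQ'
  have hi := h.twin_aux hPR c c' hlt hcl'
  generalize u Q = x at *
  generalize v Q = y at *
  generalize u Q' = x' at *
  generalize v Q' = y' at *
  obtain ⟨c1, c2, c3, c4⟩ := id c
  obtain ⟨d1, d2, d3, d4⟩ := id c'
  have e1 : a x ≠ a x' := by
    intro e
    have := h.ainj _ _ e
    subst this; omega
  have e2 : a y ≠ a y' := by
    intro e
    have := h.ainj _ _ e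
    subst this; omega
  have l1 : a x < a y := h.lta (by omega)
  have l2 : a x < a y' := h.lta (by omega)
  have l3 : a x' < a y := h.lta (by omega)
  have l4 : a x' < a y' := h.lta (by omega)
  rcases lt_or_gt_of_ne e1 with e1 | e1 <;> rcases lt_or_gt_of_ne e2 with e2 | e2
  · have := h.g2 (w1 := x) (w2 := x') (w3 := y) (w4 := y') e1 l3 e2 (by omega) (by omega) (by omega)
    omega
  · exact ⟨Q, hQ, Q', hQ', x, x', y, y', c, c', hne, e1, e2, by omega⟩
  · exact ⟨Q', hQ', Q, hQ, x', x, y', y, c', c, hne.symm, e1, e2, by omega⟩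
  · have := h.g2 (w1 := x') (w2 := x) (w3 := y') (w4 := y) e1 l2 e2 (by omega) (by omega) (by omega)
    omega

lemma Sys.noncross (h : Sys G f g L a b σ τ I) {P1 P2 R1 R2 : ℕ} (h1 : P1 < P2) (h2 : P2 < R1)
    (h3 : R1 < R2) (T1 T2 : Finset ℕ) (hT1 : 5 ≤ T1.card) (hT2 : 5 ≤ T2.card)
    (hc1 : ∀ Q ∈ T1, ∃ w w', Cm a b σ τ P1 R1 Q w w')
    (hc2 : ∀ Q ∈ T2, ∃ w w', Cm a b σ τ P2 R2 Q w w') : False := by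
  classical
  obtain ⟨Q, hQ, Q', hQ', x1, x1', y1, y1', t1⟩ := h.twin (h1.trans h2) T1 (by omega) hc1
  obtain ⟨S, hS, S', hS', x2, x2', y2, y2', t2⟩ := h.twin (h2.trans h3) ((T2.erase Q).erase Q')
    (by
      have := Finset.pred_card_le_card_erase (s := T2) (a := Q)
      have := Finset.pred_card_le_card_erase (s := T2.erase Q) (a := Q')
      omega)
    (fun Q hQ => hc2 Q (Finset.mem_of_mem_erase (Finset.mem_of_mem_erase hQ)))
  simp only [Finset.mem_erase] at hS hS'
  obtain ⟨c1, c2, c3, c4⟩ := t1.c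
  obtain ⟨d1, d2, d3, d4⟩ := t1.c'
  obtain ⟨c1', c2', c3', c4'⟩ := t2.c
  obtain ⟨d1', d2', d3', d4'⟩ := t2.c'
  have n1 := t1.ne
  have n2 := t2.ne
  have i1 := t1.ineq
  have i2 := t2.ineq
  have k1 := t1.l1
  have k2 := t1.l2
  have k3 := t2.l1
  have k4 := t2.l2
  have := h.g3 (w1 := x1) (w2 := x1') (w3 := x2) (w4 := x2') (w5 := y1') (w6 := y1)
    (w7 := y2') (w8 := y2) k1 (h.lta (by rw [d1, c1']; exact h1)) k3
    (h.lta (by rw [d1', d3]; exact h2)) k2 (h.lta (by rw [c3, d3']; exact h3)) k4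
    (c2.trans c4.symm) (d4'.trans d2'.symm) (d4.trans d2.symm) (c2'.trans c4'.symm)
    (by rw [c2, d4']; exact hS'.2.1.symm) (by rw [c2, d4]; exact n1)
    (by rw [c2, c2']; exact hS.2.1.symm) (by rw [d4', d4]; exact hS'.1)
    (by rw [d4', c2']; exact n2.symm) (by rw [d4, c2']; exact hS.1.symm)
  clear * - this i1 i2
  linarith

lemma Sys.count [Fintype ι] (h : Sys G f g L a b σ τ I) {n : ℕ} (hs : ∀ w, σ (a w) < n)
    (ht : ∀ w, τ (b w) < n) :
    Fintype.card ι ≤ n ^ 2 ∧ Fintype.card ι ^ 2 ≤ 9 * n ^ 3 := by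
  classical
  let E : Finset (ℕ × ℕ) := Finset.univ.image (fun w => (σ (a w), τ (b w)))
  have hcard : E.card = Fintype.card ι := by
    rw [Finset.card_image_of_injective, Finset.card_univ]
    intro w w' e
    simp only [Prod.mk.injEq] at e
    exact h.st_inj e.1 e.2
  have hmem : ∀ p q, (p, q) ∈ E ↔ ∃ w, σ (a w) = p ∧ τ (b w) = q := by
    intro p q; simp [E]
  rw [← hcard]
  let N : ℕ → ℕ → Finset ℕ := fun p r =>
    (Finset.range n).filter (fun q => (p, q) ∈ E ∧ (r, q) ∈ E)
  have hNc : ∀ p r, ∀ Q ∈ N p r, ∃ w w', Cm a b σ τ p r Q w w' := by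
    intro p r Q hQ
    obtain ⟨h1, h2⟩ := (Finset.mem_filter.1 hQ).2
    obtain ⟨w, h3, h4⟩ := (hmem _ _).1 h1
    obtain ⟨w', h5, h6⟩ := (hmem _ _).1 h2
    exact ⟨w, w', h3, h4, h5, h6⟩
  let F : Finset (ℕ × ℕ) := (Finset.range n ×ˢ Finset.range n).filter
    (fun e => e.1 < e.2 ∧ 5 ≤ (N e.1 e.2).card)
  refine edge_count n E ?_ F ?_ ?_
  · intro p q hpq
    obtain ⟨w, rfl, rfl⟩ := (hmem _ _).1 hpq
    exact ⟨hs w, ht w⟩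
  · refine fat_count n F ?_ ?_
    · intro p r hpr
      simp only [F, Finset.mem_filter, Finset.mem_product, Finset.mem_range] at hpr
      exact ⟨hpr.2.1, hpr.1.2⟩
    · intro p r p' r' h1 h2 h3 h4 h5
      simp only [F, Finset.mem_filter] at h1 h2
      exact h.noncross h3 h4 h5 _ _ h1.2.2 h2.2.2 (hNc _ _) (hNc _ _)
  · intro p r hpr hr h5
    simp only [F, Finset.mem_filter, Finset.mem_product, Finset.mem_range]
    exact ⟨⟨by omega, hr⟩, hpr, h5⟩

end comb
end LC

namespace LC
section menger
variable {V : Type}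

/-- directed walks from `A` to `B`, as lists -/
def Pth (E : Finset (V × V)) (A B : Finset V) (l : List V) : Prop :=
  l.IsChain (fun u v => (u, v) ∈ E) ∧ (∃ h ∈ A, l.head? = some h) ∧ (∃ t ∈ B, l.getLast? = some t)

/-- strict paths from `A` to `B` -/
structure SPth (E : Finset (V × V)) (A B : Finset V) (l : List V) : Prop where
  pth : Pth E A B l
  nd : l.Nodup
  hA : ∀ p v q, l = p ++ v :: q → v ∈ A → p = []
  hB : ∀ p v q, l = p ++ v :: q → v ∈ B → q = []

variable {E : Finset (V × V)} {A B A' B' : Finset V}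

lemma Pth.pre {p q : List V} {v : V} (h : Pth E A B (p ++ v :: q)) (hv : v ∈ B') :
    Pth E A B' (p ++ [v]) := by
  obtain ⟨h1, ⟨a, ha, h2⟩, _⟩ := h
  refine ⟨(List.isChain_split.1 h1).1, ⟨a, ha, ?_⟩, ⟨v, hv, by simp⟩⟩
  cases p <;> simpa using h2

lemma Pth.suf {p q : List V} {v : V} (h : Pth E A B (p ++ v :: q)) (hv : v ∈ A') :
    Pth E A' B (v :: q) := by
  obtain ⟨h1, _, ⟨a, ha, h2⟩⟩ := h
  refine ⟨(List.isChain_split.1 h1).2, ⟨v, hv, by simp⟩, ⟨a, ha, ?_⟩⟩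
  simpa [List.getLast?_append] using h2

lemma Pth.join {p q : List V} {v : V} (h : Pth E A B (p ++ [v])) (h' : Pth E A' B' (v :: q)) :
    Pth E A B' (p ++ v :: q) := by
  obtain ⟨h1, ⟨a, ha, h2⟩, _⟩ := h
  obtain ⟨h1', _, ⟨a', ha', h2'⟩⟩ := h'
  refine ⟨List.isChain_split.2 ⟨h1, h1'⟩, ⟨a, ha, ?_⟩, ⟨a', ha', ?_⟩⟩
  · cases p <;> simpa using h2
  · simpa [List.getLast?_append] using h2'

lemma nodup_of_split {l : List V} (h : ∀ p v q, l = p ++ v :: q → v ∉ q) : l.Nodup := by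
  induction l with
  | nil => simp
  | cons a l ih =>
    rw [List.nodup_cons]
    refine ⟨h [] a l rfl, ih fun p v q e => h (a :: p) v q (by rw [e]; rfl)⟩

lemma Pth.shorten {l : List V} (h : Pth E A B l) : ∃ l', SPth E A B l' ∧ ∀ v ∈ l', v ∈ l := by
  induction hn : l.length using Nat.strong_induction_on generalizing l with
  | _ n ih =>
  subst hn
  by_cases hs : SPth E A B l
  · exact ⟨l, hs, fun _ h => h⟩
  have key : ∀ m : List V, Pth E A B m → m.length < l.length → (∀ v ∈ m, v ∈ l) →
      ∃ l', SPth E A B l' ∧ ∀ v ∈ l', v ∈ l := by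
    intro m hm hl hsub
    obtain ⟨l', h1, h2⟩ := ih m.length hl hm rfl
    exact ⟨l', h1, fun v hv => hsub v (h2 v hv)⟩
  by_contra hcon
  apply hs
  refine ⟨h, nodup_of_split ?_, ?_, ?_⟩
  · rintro p v q rfl hv
    obtain ⟨q1, q2, rfl⟩ := List.append_of_mem hv
    apply hcon
    have h1 := h.pre (B' := {v}) (by simp)
    have h2 : Pth E {v} B (v :: q2) :=
      Pth.suf (p := p ++ v :: q1) (by simpa using h) (by simp)
    refine key _ (h1.join h2) (by simp) ?_
    intro w hw
    simp only [List.mem_append, List.mem_cons] at hw ⊢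
    tauto
  · rintro p v q rfl hv
    by_contra hp
    apply hcon
    refine key _ (h.suf hv) ?_ ?_
    · have := List.length_pos_iff.2 hp
      simp; omega
    · intro w hw; exact List.mem_append_right _ hw
  · rintro p v q rfl hv
    by_contra hp
    apply hcon
    refine key _ (h.pre hv) ?_ ?_
    · have := List.length_pos_iff.2 hp
      simp; omega
    · intro w hw
      simp only [List.mem_append, List.mem_cons, List.not_mem_nil, or_false] at hw ⊢
      tauto

lemma first_split {l : List V} {T : Finset V} (h : ∃ v ∈ l, v ∈ T) :
    ∃ p u q, l = p ++ u :: q ∧ u ∈ T ∧ ∀ v ∈ p, v ∉ T := by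
  induction l with
  | nil => simp at h
  | cons a l ih =>
    by_cases ha : a ∈ T
    · exact ⟨[], a, l, rfl, ha, by simp⟩
    · obtain ⟨v, hv, hT⟩ := h
      have : v ∈ l := by
        rcases List.mem_cons.1 hv with rfl | h
        · exact absurd hT ha
        · exact h
      obtain ⟨p, u, q, rfl, hu, hp⟩ := ih ⟨v, this, hT⟩
      refine ⟨a :: p, u, q, rfl, hu, ?_⟩
      intro w hw
      rcases List.mem_cons.1 hw with rfl | h
      · exact ha
      · exact hp w h

lemma last_split {l : List V} {T : Finset V} (h : ∃ v ∈ l, v ∈ T) :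
    ∃ p u q, l = p ++ u :: q ∧ u ∈ T ∧ ∀ v ∈ q, v ∉ T := by
  obtain ⟨p, u, q, e, hu, hp⟩ := first_split (l := l.reverse) (T := T) (by simpa using h)
  refine ⟨q.reverse, u, p.reverse, ?_, hu, by simpa using hp⟩
  have := congrArg List.reverse e
  simpa using this

variable [DecidableEq V]

lemma chain_erase_pre {p : List V} {u x y : V}
    (h : (p ++ [u]).IsChain (fun u v => (u, v) ∈ E)) (hx : x ∉ p) :
    (p ++ [u]).IsChain (fun u v => (u, v) ∈ E.erase (x, y)) := by
  induction p with
  | nil => simp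
  | cons a p ih =>
    rw [List.mem_cons, not_or] at hx
    rw [List.cons_append, List.isChain_cons] at h ⊢
    refine ⟨fun z hz => ?_, ih h.2 hx.2⟩
    refine Finset.mem_erase.2 ⟨?_, h.1 z hz⟩
    intro e
    exact hx.1 (Prod.mk.inj e).1.symm

lemma chain_erase_suf {q : List V} {u x y : V}
    (h : (u :: q).IsChain (fun u v => (u, v) ∈ E)) (hy : y ∉ q) :
    (u :: q).IsChain (fun u v => (u, v) ∈ E.erase (x, y)) := by
  refine List.IsChain.imp_of_mem_tail_imp ?_ h
  intro a b ha hb hab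
  refine Finset.mem_erase.2 ⟨?_, hab⟩
  intro e
  obtain ⟨_, rfl⟩ := Prod.mk.inj e
  exact hy hb

/-- `T` separates `A` from `B` -/
def Sep (E : Finset (V × V)) (A B T : Finset V) : Prop := ∀ l, Pth E A B l → ∃ v ∈ l, v ∈ T

/-- linkage of size `n` -/
def Lk (E : Finset (V × V)) (A B : Finset V) (n : ℕ) : Prop :=
  ∃ P : Fin n → List V, (∀ i, SPth E A B (P i)) ∧ ∀ i j, i ≠ j → ∀ v ∈ P i, v ∉ P j

lemma lk_of_index {K : Finset V} (P : V → List V) (hP : ∀ u ∈ K, Pth E A B (P u))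
    (hd : ∀ u ∈ K, ∀ w ∈ K, u ≠ w → ∀ v ∈ P u, v ∉ P w) : Lk E A B K.card := by
  have : ∀ u : K, ∃ l', SPth E A B l' ∧ ∀ v ∈ l', v ∈ P u := fun u => (hP u u.2).shorten
  choose Q hQ hQs using this
  let e := K.equivFin.symm
  refine ⟨fun i => Q (e i), fun i => hQ _, ?_⟩
  intro i j hij v hv hv'
  refine hd (e i) (e i).2 (e j) (e j).2 ?_ v (hQs _ _ hv) (hQs _ _ hv')
  intro h
  exact hij (e.injective (Subtype.ext h))

lemma Lk.last {n : ℕ} (h : Lk E A B n) (hB : B.card = n) :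
    ∃ p : V → List V, (∀ u ∈ B, SPth E A B (p u ++ [u])) ∧
      ∀ u ∈ B, ∀ w ∈ B, u ≠ w → ∀ v ∈ p u ++ [u], v ∉ p w ++ [w] := by
  obtain ⟨P, hP, hd⟩ := h
  have : ∀ i, ∃ t ∈ B, ∃ p, P i = p ++ [t] := by
    intro i
    obtain ⟨t, ht, h⟩ := (hP i).pth.2.2
    obtain ⟨p, hp⟩ := List.getLast?_eq_some_iff.1 h
    exact ⟨t, ht, p, hp⟩
  choose t ht p hp using this
  have tinj : Function.Injective t := by
    intro i j hij
    by_contra hne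
    exact hd i j hne (t i) (by rw [hp]; simp) (by rw [hp, hij]; simp)
  have himg : Finset.univ.image t = B := by
    apply Finset.eq_of_subset_of_card_le
    · intro v hv
      obtain ⟨i, _, rfl⟩ := Finset.mem_image.1 hv
      exact ht i
    · rw [Finset.card_image_of_injective _ tinj]; simp [hB]
  have hsur : ∀ u ∈ B, ∃ i, t i = u := by
    intro u hu
    rw [← himg] at hu
    obtain ⟨i, _, h⟩ := Finset.mem_image.1 hu
    exact ⟨i, h⟩
  have : ∀ u, ∃ l, u ∈ B → ∃ i, t i = u ∧ p i = l := by
    intro u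
    by_cases hu : u ∈ B
    · obtain ⟨i, hi⟩ := hsur u hu
      exact ⟨p i, fun _ => ⟨i, hi, rfl⟩⟩
    · exact ⟨[], fun h => absurd h hu⟩
  choose p' hp' using this
  refine ⟨p', ?_, ?_⟩
  · intro u hu
    obtain ⟨i, h1, h2⟩ := hp' u hu
    rw [← h2, ← h1, ← hp]
    exact hP i
  · intro u hu w hw hne v
    obtain ⟨i, h1, h2⟩ := hp' u hu
    obtain ⟨j, h3, h4⟩ := hp' w hw
    rw [← h2, ← h1, ← hp, ← h4, ← h3, ← hp]
    refine hd i j ?_ v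
    rintro rfl
    exact hne (h1.symm.trans h3)

lemma Lk.head {n : ℕ} (h : Lk E A B n) (hA : A.card = n) :
    ∃ p : V → List V, (∀ u ∈ A, SPth E A B (u :: p u)) ∧
      ∀ u ∈ A, ∀ w ∈ A, u ≠ w → ∀ v ∈ u :: p u, v ∉ w :: p w := by
  obtain ⟨P, hP, hd⟩ := h
  have : ∀ i, ∃ t ∈ A, ∃ p, P i = t :: p := by
    intro i
    obtain ⟨t, ht, h⟩ := (hP i).pth.2.1
    obtain ⟨p, hp⟩ := List.head?_eq_some_iff.1 h
    exact ⟨t, ht, p, hp⟩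
  choose t ht p hp using this
  have tinj : Function.Injective t := by
    intro i j hij
    by_contra hne
    exact hd i j hne (t i) (by rw [hp]; simp) (by rw [hp, hij]; simp)
  have himg : Finset.univ.image t = A := by
    apply Finset.eq_of_subset_of_card_le
    · intro v hv
      obtain ⟨i, _, rfl⟩ := Finset.mem_image.1 hv
      exact ht i
    · rw [Finset.card_image_of_injective _ tinj]; simp [hA]
  have hsur : ∀ u ∈ A, ∃ i, t i = u := by
    intro u hu
    rw [← himg] at hu
    obtain ⟨i, _, h⟩ := Finset.mem_image.1 hu
    exact ⟨i, h⟩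
  have : ∀ u, ∃ l, u ∈ A → ∃ i, t i = u ∧ p i = l := by
    intro u
    by_cases hu : u ∈ A
    · obtain ⟨i, hi⟩ := hsur u hu
      exact ⟨p i, fun _ => ⟨i, hi, rfl⟩⟩
    · exact ⟨[], fun h => absurd h hu⟩
  choose p' hp' using this
  refine ⟨p', ?_, ?_⟩
  · intro u hu
    obtain ⟨i, h1, h2⟩ := hp' u hu
    rw [← h2, ← h1, ← hp]
    exact hP i
  · intro u hu w hw hne v
    obtain ⟨i, h1, h2⟩ := hp' u hu
    obtain ⟨j, h3, h4⟩ := hp' w hw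
    rw [← h2, ← h1, ← hp, ← h4, ← h3, ← hp]
    refine hd i j ?_ v
    rintro rfl
    exact hne (h1.symm.trans h3)

lemma Pth.not_edge {l : List V} {x y : V} (h : Pth E A B l) (hn : x ∉ l ∨ y ∉ l) :
    Pth (E.erase (x, y)) A B l := by
  refine ⟨List.IsChain.imp_of_mem_imp ?_ h.1, h.2⟩
  intro a b ha hb hab
  refine Finset.mem_erase.2 ⟨?_, hab⟩
  intro e
  obtain ⟨rfl, rfl⟩ := Prod.mk.inj e
  tauto

lemma Pth.mono {E' : Finset (V × V)} (hE : E' ⊆ E) {l : List V} (h : Pth E' A B l) :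
    Pth E A B l :=
  ⟨h.1.imp fun _ _ h => hE h, h.2⟩

theorem menger (E : Finset (V × V)) (A B : Finset V) (n : ℕ)
    (h : ∀ T, Sep E A B T → n ≤ T.card) : Lk E A B n := by
  induction hn : E.card generalizing E A B n with
  | zero =>
    have hE : E = ∅ := Finset.card_eq_zero.1 hn
    subst hE
    have h1 : n ≤ (A ∩ B).card := by
      apply h
      intro l hl
      obtain ⟨h1, ⟨a, ha, h2⟩, ⟨b, hb, h3⟩⟩ := hl
      match l with
      | [] => simp at h2
      | [v] =>
        simp at h2 h3
        subst h2; subst h3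
        exact ⟨v, by simp, by simp [ha, hb]⟩
      | u :: v :: l => simp at h1
    obtain ⟨K, hK, hKc⟩ := Finset.exists_subset_card_eq h1
    rw [← hKc]
    refine lk_of_index (fun u => [u]) ?_ ?_
    · intro u hu
      have := Finset.mem_inter.1 (hK hu)
      exact ⟨by simp, ⟨u, this.1, by simp⟩, ⟨u, this.2, by simp⟩⟩
    · intro u _ w _ hne v hv hv'
      simp at hv hv'
      exact hne (hv.symm.trans hv')
  | succ N ih =>
    obtain ⟨⟨x, y⟩, he⟩ := Finset.card_pos.1 (show 0 < E.card by omega)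
    have hc : (E.erase (x, y)).card = N := by
      rw [Finset.card_erase_of_mem he]; omega
    by_cases hall : ∀ T, Sep (E.erase (x, y)) A B T → n ≤ T.card
    · obtain ⟨P, hP, hd⟩ := ih _ A B n hall hc
      refine ⟨P, fun i => ⟨(hP i).pth.mono (Finset.erase_subset _ _), (hP i).nd, (hP i).hA,
        (hP i).hB⟩, hd⟩
    push Not at hall
    obtain ⟨S, hS, hSn⟩ := hall
    have hx1 : n ≤ (insert x S).card := by
      apply h
      intro l hl
      by_cases hxl : x ∈ l
      · exact ⟨x, hxl, by simp⟩
      · obtain ⟨v, hv, hv'⟩ := hS l (hl.not_edge (Or.inl hxl))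
        exact ⟨v, hv, by simp [hv']⟩
    have hy1 : n ≤ (insert y S).card := by
      apply h
      intro l hl
      by_cases hyl : y ∈ l
      · exact ⟨y, hyl, by simp⟩
      · obtain ⟨v, hv, hv'⟩ := hS l (hl.not_edge (Or.inr hyl))
        exact ⟨v, hv, by simp [hv']⟩
    have hxS : x ∉ S := by
      intro hx
      rw [Finset.insert_eq_of_mem hx] at hx1
      omega
    have hyS : y ∉ S := by
      intro hx
      rw [Finset.insert_eq_of_mem hx] at hy1
      omega
    have hxc : (insert x S).card = n := by
      rw [Finset.card_insert_of_notMem hxS] at hx1 ⊢; omega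
    have hyc : (insert y S).card = n := by
      rw [Finset.card_insert_of_notMem hyS] at hy1 ⊢; omega
    have sepx : ∀ l, Pth E A B l → ∃ v ∈ l, v ∈ insert x S := by
      intro l hl
      by_cases hxl : x ∈ l
      · exact ⟨x, hxl, by simp⟩
      · obtain ⟨v, hv, hv'⟩ := hS l (hl.not_edge (Or.inl hxl))
        exact ⟨v, hv, by simp [hv']⟩
    have sepy : ∀ l, Pth E A B l → ∃ v ∈ l, v ∈ insert y S := by
      intro l hl
      by_cases hyl : y ∈ l
      · exact ⟨y, hyl, by simp⟩
      · obtain ⟨v, hv, hv'⟩ := hS l (hl.not_edge (Or.inr hyl))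
        exact ⟨v, hv, by simp [hv']⟩
    have L1 : Lk (E.erase (x, y)) A (insert x S) n := by
      apply ih _ _ _ _ _ hc
      intro T hT
      apply h
      intro l hl
      obtain ⟨p, u, q, rfl, hu, hp⟩ := first_split (sepx l hl)
      have hpre : Pth E A (insert x S) (p ++ [u]) := hl.pre hu
      obtain ⟨v, hv, hvT⟩ := hT (p ++ [u])
        ⟨chain_erase_pre hpre.1 (fun hx => hp x hx (by simp)), hpre.2⟩
      refine ⟨v, ?_, hvT⟩
      simp only [List.mem_append, List.mem_cons, List.not_mem_nil, or_false] at hv ⊢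
      tauto
    have L2 : Lk (E.erase (x, y)) (insert y S) B n := by
      apply ih _ _ _ _ _ hc
      intro T hT
      apply h
      intro l hl
      obtain ⟨p, u, q, rfl, hu, hp⟩ := last_split (sepy l hl)
      have hpre : Pth E (insert y S) B (u :: q) := hl.suf hu
      obtain ⟨v, hv, hvT⟩ := hT (u :: q)
        ⟨chain_erase_suf hpre.1 (fun hx => hp y hx (by simp)), hpre.2⟩
      exact ⟨v, List.mem_append_right _ hv, hvT⟩
    obtain ⟨p, hp, hpd⟩ := L1.last hxc
    obtain ⟨q, hq, hqd⟩ := L2.head hyc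
    have cross : ∀ s ∈ insert x S, ∀ s' ∈ insert y S, ∀ v, v ∈ p s ++ [s] → v ∈ s' :: q s' →
        v ∈ S ∧ v = s ∧ v = s' := by
      intro s hs s' hs' v hv hv'
      obtain ⟨p1, p2, e⟩ := List.append_of_mem hv
      obtain ⟨q1, q2, e'⟩ := List.append_of_mem hv'
      have hP := hp s hs
      have hQ := hq s' hs'
      rw [e] at hP
      rw [e'] at hQ
      have hvS : v ∈ S := by
        obtain ⟨w, hw, hwS⟩ := hS _ ((hP.pth.pre (B' := {v}) (by simp)).join
          (hQ.pth.suf (A' := {v}) (by simp)))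
        rw [List.mem_append, List.mem_cons] at hw
        rcases hw with hw | rfl | hw
        · exfalso
          obtain ⟨p3, p4, rfl⟩ := List.append_of_mem hw
          have := hP.hB p3 w (p4 ++ v :: p2) (by simp) (by simp [hwS])
          simp at this
        · exact hwS
        · exfalso
          obtain ⟨p3, p4, rfl⟩ := List.append_of_mem hw
          have := hQ.hA (q1 ++ v :: p3) w p4 (by simp) (by simp [hwS])
          simp at this
      refine ⟨hvS, ?_, ?_⟩
      · have := hP.hB p1 v p2 rfl (by simp [hvS])
        subst this
        have := congrArg List.getLast? e
        simpa using this.symm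
      · have := hQ.hA q1 v q2 rfl (by simp [hvS])
        subst this
        have h9 := e'.symm
        simp only [List.nil_append, List.cons.injEq] at h9
        exact h9.1
    rw [← hxc]
    refine lk_of_index (fun s => p s ++ s :: (if s = x then y :: q y else q s)) ?_ ?_
    · intro s hs
      have h1 := (hp s hs).pth.mono (Finset.erase_subset _ _)
      by_cases hsx : s = x
      · subst hsx
        have h2 := (hq y (by simp)).pth.mono (Finset.erase_subset _ _)
        simp only [if_true]
        refine h1.join (A' := {s}) (B' := B) ⟨?_, ⟨s, by simp, by simp⟩, ?_⟩
        · rw [List.isChain_cons_cons]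
          exact ⟨he, h2.1⟩
        · obtain ⟨t, ht, h3⟩ := h2.2.2
          exact ⟨t, ht, by simpa using h3⟩
      · simp only [hsx, if_false]
        have hsS : s ∈ S := (Finset.mem_insert.1 hs).resolve_left hsx
        exact h1.join ((hq s (by simp [hsS])).pth.mono (Finset.erase_subset _ _))
    · let φ : V → V := fun s => if s = x then y else s
      have hφ : ∀ s ∈ insert x S, φ s ∈ insert y S := by
        intro s hs
        by_cases hsx : s = x
        · simp [φ, hsx]
        · have hsS : s ∈ S := (Finset.mem_insert.1 hs).resolve_left hsx
          simp [φ, hsx, hsS]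
      have hmem : ∀ s, ∀ v ∈ p s ++ s :: (if s = x then y :: q y else q s),
          v ∈ p s ++ [s] ∨ v ∈ φ s :: q (φ s) := by
        intro s v hv
        by_cases hsx : s = x
        · simp only [φ, hsx, if_true, List.mem_append, List.mem_cons] at hv ⊢
          tauto
        · simp only [φ, hsx, if_false, List.mem_append, List.mem_cons] at hv ⊢
          tauto
      have hφc : ∀ s ∈ insert x S, ∀ s' ∈ insert x S, ∀ v, v ∈ S → v = s → v = φ s' → s = s' := by
        intro s hs s' hs' v hv h1 h2
        by_cases hsx : s' = x
        · simp only [φ, hsx, if_true] at h2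
          rw [h2] at hv
          exact absurd hv hyS
        · simp only [φ, hsx, if_false] at h2
          exact h1.symm.trans h2
      have hφi : ∀ s ∈ insert x S, ∀ s' ∈ insert x S, φ s = φ s' → s = s' := by
        intro s hs s' hs' h
        rw [Finset.mem_insert] at hs hs'
        by_cases h1 : s = x <;> by_cases h2 : s' = x
        · rw [h1, h2]
        · simp only [φ, h1, h2, if_true, if_false] at h
          rw [h] at hyS
          tauto
        · simp only [φ, h1, h2, if_true, if_false] at h
          rw [← h] at hyS
          tauto
        · simpa only [φ, h1, h2, if_false] using h
      intro s hs s' hs' hne v hv hv'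
      rcases hmem s v hv with h1 | h1 <;> rcases hmem s' v hv' with h2 | h2
      · exact hpd s hs s' hs' hne v h1 h2
      · obtain ⟨h3, h4, h5⟩ := cross s hs _ (hφ s' hs') v h1 h2
        exact hne (hφc s hs s' hs' v h3 h4 h5)
      · obtain ⟨h3, h4, h5⟩ := cross s' hs' _ (hφ s hs) v h2 h1
        exact hne (hφc s' hs' s hs v h3 h4 h5).symm
      · exact hqd _ (hφ s hs) _ (hφ s' hs') (fun e => hne (hφi s hs s' hs' e)) v h1 h2

end menger
end LC

namespace LC
section fin
variable {V : Type} {G : SimpleGraph V}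

lemma cyc_of_walk {x : V} {X : G.Walk x x} (h : X.IsCycle) : Cyc G X.getVert X.length where
  pos := by have := h.three_le_length; omega
  inj := by
    intro i j hi hj e
    refine h.getVert_injOn' ?_ ?_ e
    · show i ≤ X.length - 1
      omega
    · show j ≤ X.length - 1
      omega
  adj := fun i hi => X.adj_getVert_succ (by omega)
  close := by
    have h3 := h.three_le_length
    have := X.adj_getVert_succ (i := X.length - 1) (by omega)
    rw [Nat.sub_add_cancel (by omega), X.getVert_length] at this
    rwa [X.getVert_zero]

lemma mem_cyc {x : V} {X : G.Walk x x} (h : X.IsCycle) (v : V) :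
    v ∈ X.support ↔ ∃ i < X.length, X.getVert i = v := by
  have h3 := h.three_le_length
  rw [Walk.mem_support_iff_exists_getVert]
  constructor
  · rintro ⟨i, rfl, hi⟩
    rcases hi.lt_or_eq with h | h
    · exact ⟨i, h, rfl⟩
    · exact ⟨0, by omega, by rw [h, X.getVert_length, X.getVert_zero]⟩
  · rintro ⟨i, hi, rfl⟩
    exact ⟨i, rfl, hi.le⟩

lemma walk_of_chain (l : List V) : ∀ a b : V, J G a b l →
    ∃ W : G.Walk a b, W.support = a :: (l ++ [b]) := by
  induction l with
  | nil =>
    intro a b h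
    have : G.Adj a b := by simpa [J] using h
    exact ⟨Walk.cons this Walk.nil, by simp⟩
  | cons c l ih =>
    intro a b h
    unfold J at h
    rw [List.cons_append, List.isChain_cons_cons] at h
    obtain ⟨W, hW⟩ := ih c b h.2
    exact ⟨Walk.cons h.1 W, by simp [hW]⟩

lemma bd_of_longest {x : V} {X : G.Walk x x} (h : IsLongestCycle G X) : Bd G X.length := by
  intro a z hn hJ
  have h3 := h.1.three_le_length
  by_cases hl : (a :: z).length < 3
  · omega
  match z, hn, hJ, hl with
  | [], _, _, hl => simp at hl
  | c :: z, hn, hJ, hl =>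
    unfold J at hJ
    rw [List.cons_append, List.isChain_cons_cons] at hJ
    obtain ⟨W, hW⟩ := walk_of_chain z c a hJ.2
    have hlen : W.length + 1 = (c :: (z ++ [a])).length := by
      rw [← hW, Walk.length_support]
    simp at hlen hl
    have := h.2 a (Walk.cons hJ.1 W) (by
      rw [Walk.isCycle_iff_isPath_tail_and_le_length]
      refine ⟨?_, ?_⟩
      · rw [Walk.isPath_def, Walk.support_tail_of_not_nil _ (by simp), Walk.support_cons,
          List.tail_cons, hW, ← List.cons_append]
        exact (List.perm_append_singleton a (c :: z)).nodup_iff.2 hn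
      · simp only [Walk.length_cons]
        omega)
    simp only [Walk.length_cons] at this
    simp only [List.length_cons]
    omega


lemma sub_walk (T : Finset V) {c d : ((⊤ : G.Subgraph).deleteVerts ↑T).verts}
    (W : ((⊤ : G.Subgraph).deleteVerts ↑T).coe.Walk c d) :
    ∃ W : G.Walk c.1 d.1, ∀ v ∈ W.support, v ∉ T := by
  induction W with
  | @nil u =>
    refine ⟨Walk.nil, ?_⟩
    intro v hv
    rw [Walk.support_nil, List.mem_singleton] at hv
    subst hv
    have := u.2
    simpa using this
  | @cons u v w h p ih =>
    obtain ⟨W, hW⟩ := ih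
    refine ⟨Walk.cons (Subgraph.coe_adj_sub _ u v h) W, ?_⟩
    intro z hz
    rw [Walk.support_cons, List.mem_cons] at hz
    rcases hz with rfl | hz
    · have := u.2
      simpa using this
    · exact hW z hz

variable [Fintype V] [DecidableEq V]

lemma conn {k : ℕ} (h : IsKConnected G k) {T : Finset V} (hT : T.card < k) {c d : V}
    (hc : c ∉ T) (hd : d ∉ T) : ∃ W : G.Walk c d, ∀ v ∈ W.support, v ∉ T := by
  have hcon := h.2 T hT
  obtain ⟨W⟩ := hcon.preconnected ⟨c, by simpa using hc⟩ ⟨d, by simpa using hd⟩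
  exact sub_walk T W

lemma deg {k : ℕ} (h : IsKConnected G k) (v : V) (T : Finset V) (hT : ∀ u, u ∈ T ↔ G.Adj v u) :
    k ≤ T.card := by
  by_contra hlt
  push Not at hlt
  have hv : v ∉ T := fun hv => G.loopless.irrefl v ((hT v).1 hv)
  have : (insert v T).card < (Finset.univ : Finset V).card := by
    have := Finset.card_insert_le v T
    have := h.1
    rw [Finset.card_univ]
    omega
  obtain ⟨d, _, hd⟩ := Finset.exists_mem_notMem_of_card_lt_card this
  rw [Finset.mem_insert, not_or] at hd
  obtain ⟨W, hW⟩ := conn h hlt hv hd.2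
  cases W with
  | nil => exact hd.1 rfl
  | cons hadj p =>
    refine hW _ ?_ ((hT _).2 hadj)
    simp

lemma long {k L : ℕ} (hk : 2 ≤ k) (h : IsKConnected G k) (hb : Bd G L) : k < L := by
  classical
  have hne : Nonempty V := Fintype.card_pos_iff.1 (by have := h.1; omega)
  obtain ⟨v0⟩ := hne
  let Q : ℕ → Prop := fun d => ∃ l : List V, l.Nodup ∧ l.IsChain G.Adj ∧ l.length = d
  have h1 : Q 1 := ⟨[v0], by simp, by simp, by simp⟩
  have hle : ∀ d, Q d → d ≤ Fintype.card V := by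
    rintro d ⟨l, hl, _, rfl⟩
    exact hl.length_le_card
  have hs := Nat.findGreatest_spec (P := Q) (hle 1 h1) h1
  have hpos : 1 ≤ Nat.findGreatest Q (Fintype.card V) := Nat.le_findGreatest (hle 1 h1) h1
  obtain ⟨l, hl, hch, hlen⟩ := hs
  match l, hl, hch, hlen with
  | [], _, _, hlen => simp at hlen; omega
  | v :: l, hl, hch, hlen =>
    let T : Finset V := Finset.univ.filter (fun u => G.Adj v u)
    have hT : ∀ u, u ∈ T ↔ G.Adj v u := by intro u; simp [T]
    have hdeg := deg h v T hT
    have hTl : ∀ u ∈ T, u ∈ l := by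
      intro u hu
      by_contra hul
      have hadj := (hT u).1 hu
      have : Q ((v :: l).length + 1) := by
        refine ⟨u :: v :: l, ?_, ?_, by simp⟩
        · rw [List.nodup_cons]
          refine ⟨?_, hl⟩
          rw [List.mem_cons, not_or]
          exact ⟨hadj.ne.symm, hul⟩
        · rw [List.isChain_cons_cons]
          exact ⟨hadj.symm, hch⟩
      have := Nat.le_findGreatest (hle _ this) this
      omega
    have hTn : T.Nonempty := Finset.card_pos.1 (by omega)
    obtain ⟨u0, hu0⟩ := hTn
    obtain ⟨p, u, q, rfl, hu, hq⟩ := last_split (l := l) (T := T) ⟨u0, hTl u0 hu0, hu0⟩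
    have hTp : T ⊆ (p ++ [u]).toFinset := by
      intro w hw
      have h2 := hTl w hw
      have h3 : w ∉ q := fun hwq => hq w hwq hw
      simp only [List.mem_append, List.mem_cons] at h2
      simp only [List.mem_toFinset, List.mem_append, List.mem_singleton]
      tauto
    have h5 : T.card ≤ (p ++ [u]).length :=
      (Finset.card_le_card hTp).trans (List.toFinset_card_le _)
    have hJ : J G v v (p ++ [u]) := by
      have e1 : v :: (p ++ u :: q) = (v :: p) ++ u :: q := rfl
      rw [e1, List.isChain_split] at hch
      have h6 : J G v u p := hch.1
      have h7 : J G u v [] := by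
        have := ((hT u).1 hu).symm
        simpa [J] using this
      exact h6.comp h7
    have h8 := hb v (p ++ [u]) (by
      refine List.Nodup.sublist ?_ hl
      rw [List.cons_sublist_cons]
      exact List.Sublist.append_left (by simp) p) hJ
    simp only [List.length_cons] at h8
    omega

end fin
end LC

namespace LC
section asm
variable {V : Type} {G : SimpleGraph V} [DecidableEq V]

/-- the segment index -/
def seg (f : ℕ → V) (B : Finset V) (i : ℕ) : ℕ := ((Finset.range i).filter (fun y => f y ∈ B)).card

lemma seg_mono (f : ℕ → V) (B : Finset V) : Monotone (seg f B) := by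
  intro i j hij
  refine Finset.card_le_card ?_
  intro y hy
  simp only [Finset.mem_filter, Finset.mem_range] at hy ⊢
  exact ⟨by omega, hy.2⟩

lemma seg_succ (f : ℕ → V) (B : Finset V) (i : ℕ) (h : f i ∈ B) :
    seg f B (i + 1) = seg f B i + 1 := by
  unfold seg
  rw [Finset.range_add_one, Finset.filter_insert, if_pos h, Finset.card_insert_of_notMem]
  simp

lemma seg_le {f : ℕ → V} {A B : Finset V} {L i : ℕ} (hf : Cyc G f L)
    (hA : ∀ v, v ∈ A ↔ ∃ x < L, f x = v) (hi : i < L) : seg f B i ≤ (A ∩ B).card := by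
  refine Finset.card_le_card_of_injOn f ?_ ?_
  · intro y hy
    simp only [Finset.coe_filter, Set.mem_ofPred_eq, Finset.mem_range] at hy
    simp only [Finset.coe_inter, Set.mem_inter_iff, Finset.mem_coe]
    exact ⟨(hA _).2 ⟨y, by omega, rfl⟩, hy.2⟩
  · intro y hy z hz e
    simp only [Finset.coe_filter, Set.mem_ofPred_eq, Finset.mem_range] at hy hz
    exact hf.inj y z (by omega) (by omega) e

lemma seg_off {f : ℕ → V} {B : Finset V} {i j x : ℕ} (h : seg f B i = seg f B j) (h1 : i ≤ x)
    (h2 : x ≤ j) (hj : f j ∉ B) : f x ∉ B := by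
  intro hx
  rcases h2.lt_or_eq with h3 | h3
  · have a1 := seg_mono f B h1
    have a2 := seg_succ f B x hx
    have a3 := seg_mono f B (show x + 1 ≤ j by omega)
    omega
  · subst h3; exact hj hx

lemma core {f g : ℕ → V} {L k : ℕ} (hf : Cyc G f L) (hg : Cyc G g L) (hb : Bd G L)
    {A B : Finset V} (hA : ∀ v, v ∈ A ↔ ∃ x < L, f x = v) (hB : ∀ v, v ∈ B ↔ ∃ x < L, g x = v)
    (E : Finset (V × V)) (hE : ∀ u v, (u, v) ∈ E → G.Adj u v) (hlk : Lk E A B k) :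
    ∃ e : ℕ, e ≤ ((A ∩ B).card + 1) ^ 2 ∧ e ^ 2 ≤ 9 * ((A ∩ B).card + 1) ^ 3 ∧
      k ≤ e + (A ∩ B).card := by
  classical
  obtain ⟨P, hP, hd⟩ := hlk
  let ι : Type := {i : Fin k // 2 ≤ (P i).length}
  have hdat : ∀ w : ι, ∃ a b I, a < L ∧ b < L ∧ P w.1 = f a :: (I ++ [g b]) := by
    intro w
    obtain ⟨_, ⟨h, hh, e1⟩, ⟨t, ht, e2⟩⟩ := (hP w.1).pth
    obtain ⟨a, ha, rfl⟩ := (hA h).1 hh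
    obtain ⟨b, hb, rfl⟩ := (hB t).1 ht
    obtain ⟨q, hq⟩ := List.head?_eq_some_iff.1 e1
    have hw := w.2
    rw [hq] at e2 hw
    have hqne : q ≠ [] := by
      rintro rfl
      simp at hw
    have e3 : q.getLast? = some (g b) := by
      rw [List.getLast?_cons_of_ne_nil hqne] at e2
      exact e2
    obtain ⟨I, rfl⟩ := List.getLast?_eq_some_iff.1 e3
    exact ⟨a, b, I, ha, hb, hq⟩
  choose a b I ha hb' hPI using hdat
  have hfB : ∀ w, f (a w) ∉ B := by
    intro w hw
    have := (hP w.1).hB [] (f (a w)) _ (by rw [hPI]; rfl) hw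
    simp at this
  have hgA : ∀ w, g (b w) ∉ A := by
    intro w hw
    have := (hP w.1).hA (f (a w) :: I w) (g (b w)) [] (by rw [hPI]; simp) hw
    simp at this
  have hne : ∀ w w' : ι, ∀ v ∈ P w.1, v ∈ P w'.1 → w = w' := by
    intro w w' v h1 h2
    by_contra hc
    exact hd w.1 w'.1 (fun e => hc (Subtype.ext e)) v h1 h2
  have hIm : ∀ w, ∀ v ∈ I w, v ∈ P w.1 := by
    intro w v hv
    rw [hPI]; simp [hv]
  have hS : Sys G f g L a b (seg f B) (seg g A) I :=
    { cf := hf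
      cg := hg
      bd := hb
      ha := ha
      hb := hb'
      hJ := by
        intro w
        have h1 := (hP w.1).pth.1
        rw [hPI] at h1
        exact h1.imp fun u v h => hE u v h
      nd := by
        intro w
        have h1 := (hP w.1).nd
        rw [hPI] at h1
        exact (List.nodup_append.1 (List.nodup_cons.1 h1).2).1
      dis := by
        intro w w' hww v hv hv'
        exact hww (hne w w' v (hIm w v hv) (hIm w' v hv'))
      offf := by
        rintro w v hv x hx rfl
        obtain ⟨p, q, e⟩ := List.append_of_mem hv
        have := (hP w.1).hA (f (a w) :: p) (f x) (q ++ [g (b w)]) (by rw [hPI, e]; simp)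
          ((hA _).2 ⟨x, hx, rfl⟩)
        simp at this
      offg := by
        rintro w v hv x hx rfl
        obtain ⟨p, q, e⟩ := List.append_of_mem hv
        have := (hP w.1).hB (f (a w) :: p) (g x) (q ++ [g (b w)]) (by rw [hPI, e]; simp)
          ((hB _).2 ⟨x, hx, rfl⟩)
        simp at this
      ainj := by
        intro w w' e
        exact hne w w' (f (a w)) (by rw [hPI]; simp) (by rw [hPI, e]; simp)
      binj := by
        intro w w' e
        exact hne w w' (g (b w)) (by rw [hPI]; simp) (by rw [hPI, e]; simp)
      sm := seg_mono f B
      tm := seg_mono g A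
      segf := by
        intro w w' e x h1 h2 y hy e2
        exact seg_off e h1 h2 (hfB w') ((hB _).2 ⟨y, hy, e2⟩)
      segg := by
        intro w w' e x h1 h2 y hy e2
        exact seg_off e h1 h2 (hgA w') ((hA _).2 ⟨y, hy, e2⟩) }
  have hc := hS.count (n := (A ∩ B).card + 1) (fun w => Nat.lt_succ_of_le (seg_le hf hA (ha w)))
    (fun w => Nat.lt_succ_of_le (by rw [Finset.inter_comm]; exact seg_le hg hB (hb' w)))
  refine ⟨Fintype.card ι, hc.1, hc.2, ?_⟩
  have hcomp : Fintype.card {i : Fin k // ¬ 2 ≤ (P i).length} ≤ (A ∩ B).card := by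
    have htr : ∀ w : {i : Fin k // ¬ 2 ≤ (P i).length}, ∃ v, v ∈ A ∩ B ∧ v ∈ P w.1 := by
      intro w
      obtain ⟨_, ⟨h, hh, e1⟩, ⟨t, ht, e2⟩⟩ := (hP w.1).pth
      obtain ⟨q, hq⟩ := List.head?_eq_some_iff.1 e1
      have hw := w.2
      rw [hq] at hw e2
      have : q = [] := by
        cases q with
        | nil => rfl
        | cons _ _ => simp at hw
      subst this
      simp at e2
      subst e2
      exact ⟨h, Finset.mem_inter.2 ⟨hh, ht⟩, by rw [hq]; simp⟩
    choose v hv hvP using htr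
    rw [← Finset.card_univ]
    refine Finset.card_le_card_of_injOn v (fun w _ => hv w) ?_
    intro w _ w' _ e
    by_contra hc
    exact hd w.1 w'.1 (fun e => hc (Subtype.ext e)) (v w) (hvP w) (by rw [e]; exact hvP w')
  have := Fintype.card_subtype_compl (fun i : Fin k => 2 ≤ (P i).length)
  have h2 := Fintype.card_subtype_le (fun i : Fin k => 2 ≤ (P i).length)
  rw [Fintype.card_fin] at this h2
  change Fintype.card ι ≤ k at h2
  change _ = k - Fintype.card ι at this
  omega

lemma link [Fintype V] {k : ℕ} (h : IsKConnected G k) {A B : Finset V} (hA : k ≤ A.card)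
    (hB : k ≤ B.card) (E : Finset (V × V)) (hE : ∀ u v, G.Adj u v → (u, v) ∈ E) :
    Lk E A B k := by
  apply menger
  intro T hT
  by_contra hlt
  push Not at hlt
  obtain ⟨c, hc, hcT⟩ := Finset.exists_mem_notMem_of_card_lt_card (hlt.trans_le hA)
  obtain ⟨d, hd, hdT⟩ := Finset.exists_mem_notMem_of_card_lt_card (hlt.trans_le hB)
  obtain ⟨W, hW⟩ := conn h hlt hcT hdT
  obtain ⟨v, hv, hvT⟩ := hT W.support
    ⟨W.isChain_adj_support.imp fun u v h => hE u v h, ⟨c, hc, by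
      rw [List.head?_eq_some_iff]; exact ⟨_, W.cons_tail_support.symm⟩⟩, ⟨d, hd, by
      rw [List.getLast?_eq_some_iff]; exact ⟨_, W.dropLast_support_concat.symm⟩⟩⟩
  exact hW v hv hvT

lemma card_cyc {f : ℕ → V} {A : Finset V} {L : ℕ} (hf : Cyc G f L)
    (hA : ∀ v, v ∈ A ↔ ∃ x < L, f x = v) : L ≤ A.card := by
  have : (Finset.range L).card ≤ A.card := by
    refine Finset.card_le_card_of_injOn f ?_ ?_
    · intro y hy
      exact (hA _).2 ⟨y, by simpa using hy, rfl⟩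
    · intro y hy z hz e
      exact hf.inj y z (by simpa using hy) (by simpa using hz) e
  simpa using this

lemma main_nat [Fintype V] {k : ℕ} (hk : 2 ≤ k) (h : IsKConnected G k) {x y : V} (X : G.Walk x x)
    (Y : G.Walk y y) (hX : IsLongestCycle G X) (hY : IsLongestCycle G Y) :
    k ^ 2 ≤ 216 * (X.support.toFinset ∩ Y.support.toFinset).card ^ 3 := by
  classical
  have hL : Y.length = X.length := le_antisymm (hX.2 _ Y hY.1) (hY.2 _ X hX.1)
  have hf := cyc_of_walk hX.1
  have hg := cyc_of_walk hY.1
  have hb := bd_of_longest hX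
  have hA : ∀ v, v ∈ X.support.toFinset ↔ ∃ i < X.length, X.getVert i = v := by
    intro v; rw [List.mem_toFinset]; exact mem_cyc hX.1 v
  have hB : ∀ v, v ∈ Y.support.toFinset ↔ ∃ i < X.length, Y.getVert i = v := by
    intro v; rw [List.mem_toFinset, ← hL]; exact mem_cyc hY.1 v
  rw [hL] at hg
  have hlong := long hk h hb
  let E : Finset (V × V) := Finset.univ.filter (fun e => G.Adj e.1 e.2)
  have hE : ∀ u v, (u, v) ∈ E ↔ G.Adj u v := by intro u v; simp [E]
  have hlk := link h (hlong.le.trans (card_cyc hf hA)) (hlong.le.trans (card_cyc hg hB)) E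
    (fun u v h => (hE u v).2 h)
  obtain ⟨e, h1, h2, h3⟩ := core hf hg hb hA hB E (fun u v h => (hE u v).1 h) hlk
  generalize (X.support.toFinset ∩ Y.support.toFinset).card = m at *
  rcases Nat.eq_zero_or_pos m with rfl | hm
  · simp at h1
    omega
  · have h4 : (m + 1) ^ 3 ≤ (2 * m) ^ 3 := Nat.pow_le_pow_left (by omega) 3
    have h5 : m ^ 2 ≤ m ^ 3 := Nat.pow_le_pow_right hm (by omega)
    have h6 : k ^ 2 ≤ (e + m) ^ 2 := Nat.pow_le_pow_left h3 2
    have h7 : (e + m) ^ 2 ≤ 2 * e ^ 2 + 2 * m ^ 2 := by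
      zify
      nlinarith [sq_nonneg ((e : ℤ) - m)]
    have h8 : (2 * m) ^ 3 = 8 * m ^ 3 := by ring
    omega

end asm
end LC

theorem stmt_1 :
    ∃ c : ℝ, 0 < c ∧
      ∀ (k : ℕ), 2 ≤ k →
        ∀ (V : Type) [Fintype V] [DecidableEq V] (G : SimpleGraph V),
          IsKConnected G k →
          ∀ {x y : V} (X : G.Walk x x) (Y : G.Walk y y),
            IsLongestCycle G X → IsLongestCycle G Y →
            c * (k : ℝ) ^ ((2 : ℝ) / 3) ≤
              ((X.support.toFinset ∩ Y.support.toFinset).card : ℝ) := by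
  refine ⟨1 / 6, by norm_num, ?_⟩
  intro k hk V _ _ G h x y X Y hX hY
  have hm := LC.main_nat hk h X Y hX hY
  generalize (X.support.toFinset ∩ Y.support.toFinset).card = m at *
  have hm' : (k : ℝ) ^ 2 ≤ 216 * (m : ℝ) ^ 3 := by exact_mod_cast hm
  have h1 : ((k : ℝ) ^ ((2 : ℝ) / 3)) ^ 3 = (k : ℝ) ^ 2 := by
    rw [← Real.rpow_natCast, ← Real.rpow_mul (Nat.cast_nonneg k), ← Real.rpow_natCast]
    norm_num
  have h2 : (k : ℝ) ^ ((2 : ℝ) / 3) ≤ 6 * m := by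
    refine le_of_pow_le_pow_left₀ (n := 3) (by norm_num) (by positivity) ?_
    rw [h1]
    calc (k : ℝ) ^ 2 ≤ _ := hm'
      _ = (6 * (m : ℝ)) ^ 3 := by ring
  linarith
end

section
/- There exists a constant c > 0 such that for all integers n > d ≥ 2, every connected d-regular vertex-transitive graph on n vertices contains a cycle of length at least c·d^(1/3)·n^(1/2). -/
open SimpleGraph

/-- `G` is vertex-transitive: any vertex can be mapped to any other by an automorphism. -/
def IsVertexTransitive {V : Type*} (G : SimpleGraph V) : Prop :=
  ∀ u v : V, ∃ g : G ≃g G, g u = v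

namespace LC

variable {V : Type} {G : SimpleGraph V}

def PE (G : SimpleGraph V) (S : Set V) (u v : V) (k : ℕ) : Prop :=
  ∃ l : List V, k ≤ l.length ∧ l.IsChain G.Adj ∧ l.Nodup ∧ (∀ x ∈ l, x ∈ S) ∧
    l.head? = some u ∧ l.getLast? = some v

def Conn (G : SimpleGraph V) (K : Set V) (x y : V) (k : ℕ) : Prop :=
  ∃ l : List V, k ≤ l.length ∧ (x :: (l ++ [y])).IsChain G.Adj ∧ l.Nodup ∧ (∀ v ∈ l, v ∈ K)

lemma chain_rev {l : List V} (h : l.IsChain G.Adj) : l.reverse.IsChain G.Adj := by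
  rw [List.isChain_reverse]
  exact h.imp (fun a b hab => hab.symm)

lemma PE.symm {S : Set V} {u v : V} {k : ℕ} (h : PE G S u v k) : PE G S v u k := by
  obtain ⟨l, h1, h2, h3, h4, h5, h6⟩ := h
  exact ⟨l.reverse, by simpa, chain_rev h2, by simpa, by simpa, by simpa, by simpa⟩

lemma Conn.symm {K : Set V} {x y : V} {k : ℕ} (h : Conn G K x y k) : Conn G K y x k := by
  obtain ⟨l, h1, h2, h3, h4⟩ := h
  refine ⟨l.reverse, by simpa, ?_, by simpa, by simpa⟩
  have := chain_rev h2
  simpa using this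

lemma Conn.mono {K K' : Set V} {x y : V} {k k' : ℕ} (h : Conn G K x y k) (hK : K ⊆ K')
    (hk : k' ≤ k) : Conn G K' x y k' := by
  obtain ⟨l, h1, h2, h3, h4⟩ := h
  exact ⟨l, hk.trans h1, h2, h3, fun v hv => hK (h4 v hv)⟩

lemma PE.join {S K T : Set V} {u x y v : V} {a b c : ℕ} (h1 : PE G S u x a)
    (h2 : Conn G K x y b) (h3 : PE G T y v c) (hSK : Disjoint S K) (hST : Disjoint S T)
    (hKT : Disjoint K T) : PE G (S ∪ K ∪ T) u v (a + b + c) := by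
  obtain ⟨l1, a1, a2, a3, a4, a5, a6⟩ := h1
  obtain ⟨l2, b1, b2, b3, b4⟩ := h2
  obtain ⟨l3, c1, c2, c3, c4, c5, c6⟩ := h3
  rw [Set.disjoint_left] at hSK hST hKT
  obtain ⟨l1', rfl⟩ := List.getLast?_eq_some_iff.1 a6
  obtain ⟨l3', rfl⟩ := List.head?_eq_some_iff.1 c5
  refine ⟨(l1' ++ [x]) ++ (l2 ++ (y :: l3')), ?_, ?_, ?_, ?_, ?_, ?_⟩
  · simp at *; omega
  · have h : (l1' ++ x :: (l2 ++ y :: l3')).IsChain G.Adj := by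
      rw [List.isChain_split]
      refine ⟨a2, ?_⟩
      have : ((x :: l2) ++ y :: l3').IsChain G.Adj := by
        rw [List.isChain_split]
        exact ⟨by simpa using b2, c2⟩
      simpa using this
    simpa using h
  · refine List.nodup_append'.2 ⟨a3, List.nodup_append'.2 ⟨b3, c3, ?_⟩, ?_⟩
    · intro z hz hz'
      exact hKT (b4 z hz) (c4 z hz')
    · intro z hz hz'
      rcases List.mem_append.1 hz' with h | h
      · exact hSK (a4 z hz) (b4 z h)
      · exact hST (a4 z hz) (c4 z h)
  · intro z hz
    rcases List.mem_append.1 hz with h | h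
    · exact Or.inl (Or.inl (a4 z h))
    rcases List.mem_append.1 h with h | h
    · exact Or.inl (Or.inr (b4 z h))
    · exact Or.inr (c4 z h)
  · rw [List.head?_append, a5]; rfl
  · rw [List.getLast?_append, List.getLast?_append, c6]; rfl

lemma Conn.join {K M K' : Set V} {x y z w : V} {k : ℕ} (h1 : Conn G K x y 0)
    (h2 : PE G M y z k) (h3 : Conn G K' w z 0) (hSK : Disjoint K M) (hST : Disjoint K K')
    (hKT : Disjoint M K') : Conn G (K ∪ M ∪ K') x w k := by
  obtain ⟨l1, a1, a2, a3, a4⟩ := h1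
  obtain ⟨l2, b1, b2, b3, b4, b5, b6⟩ := h2
  obtain ⟨l3, c1, c2, c3, c4⟩ := h3.symm
  rw [Set.disjoint_left] at hSK hST hKT
  refine ⟨l1 ++ (l2 ++ l3), ?_, ?_, ?_, ?_⟩
  · simp; omega
  · have e2 : (l2 ++ (l3 ++ [w])).IsChain G.Adj := by
      obtain ⟨l2', rfl⟩ := List.getLast?_eq_some_iff.1 b6
      have : (l2' ++ z :: (l3 ++ [w])).IsChain G.Adj := by
        rw [List.isChain_split]
        exact ⟨b2, c2⟩
      simpa using this
    obtain ⟨l2', rfl⟩ := List.head?_eq_some_iff.1 b5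
    have : ((x :: l1) ++ y :: (l2' ++ (l3 ++ [w]))).IsChain G.Adj := by
      rw [List.isChain_split]
      exact ⟨by simpa using a2, by simpa using e2⟩
    simpa using this
  · refine List.nodup_append'.2 ⟨a3, List.nodup_append'.2 ⟨b3, c3, ?_⟩, ?_⟩
    · intro z hz hz'
      exact hKT (b4 z hz) (c4 z hz')
    · intro z hz hz'
      rcases List.mem_append.1 hz' with h | h
      · exact hSK (a4 z hz) (b4 z h)
      · exact hST (a4 z hz) (c4 z h)
  · intro z hz
    rcases List.mem_append.1 hz with h | h
    · exact Or.inl (Or.inl (a4 z h))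
    rcases List.mem_append.1 h with h | h
    · exact Or.inl (Or.inr (b4 z h))
    · exact Or.inr (c4 z h)

structure Cyc_s2 (G : SimpleGraph V) (c : ℕ → V) (L : ℕ) : Prop where
  inj : Set.InjOn c (Set.Iio L)
  adj : ∀ p, p + 1 < L → G.Adj (c p) (c (p + 1))
  close : G.Adj (c (L - 1)) (c 0)
  pos : 0 < L

def IsMaxL (G : SimpleGraph V) (L : ℕ) : Prop :=
  ∀ S u v k, PE G S u v k → G.Adj v u → k ≤ L

lemma Cyc_s2.seg {c : ℕ → V} {L : ℕ} (h : Cyc_s2 G c L) {a b : ℕ} (hab : a ≤ b) (hb : b < L) :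
    PE G (c '' Set.Icc a b) (c a) (c b) (b - a + 1) := by
  refine ⟨(List.range' a (b - a + 1)).map c, by simp, ?_, ?_, ?_, ?_, ?_⟩
  · rw [List.isChain_iff_getElem]
    intro i hi
    simp at hi ⊢
    exact h.adj (a + i) (by omega)
  · apply List.Nodup.map_on _ (List.nodup_range')
    intro x hx y hy hxy
    simp [List.mem_range'] at hx hy
    exact h.inj (by simp; omega) (by simp; omega) hxy
  · intro x hx
    simp [List.mem_range'] at hx
    obtain ⟨p, hp, rfl⟩ := hx
    exact ⟨a + p, ⟨by omega, by omega⟩, rfl⟩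
  · simp [List.range'_succ]
  · rw [List.range'_1_concat]
    simp
    congr 1
    omega

lemma Cyc_s2.segdisj {c : ℕ → V} {L : ℕ} (h : Cyc_s2 G c L) {a b a' b' : ℕ}
    (h1 : b < a') (h2 : b' < L) : Disjoint (c '' Set.Icc a b) (c '' Set.Icc a' b') := by
  rw [Set.disjoint_left]
  rintro _ ⟨p, ⟨hp1, hp2⟩, rfl⟩ ⟨q, ⟨hq1, hq2⟩, hq⟩
  have := h.inj (by simp; omega) (by simp; omega) hq
  omega

lemma subL {c : ℕ → V} {L a b : ℕ} {K : Set V} (h : Disjoint K (c '' Set.Iio L)) (hb : b < L) :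
    Disjoint K (c '' Set.Icc a b) :=
  h.mono_right (Set.image_mono (fun x hx => by simp at *; omega))

lemma E1 {c : ℕ → V} {L : ℕ} (h : Cyc_s2 G c L) (hm : IsMaxL G L) {p1 p2 k : ℕ} {K : Set V}
    (h12 : p1 < p2) (h2 : p2 < L) (hK : Disjoint K (c '' Set.Iio L))
    (hC : Conn G K (c p1) (c p2) k) : k < p2 - p1 := by
  have := (h.seg (Nat.zero_le p1) (by omega)).join hC (h.seg (show p2 ≤ L - 1 by omega) (by omega))
    (subL hK (by omega)).symm (h.segdisj (by omega) (by omega)) (subL hK (by omega))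
  have := hm _ _ _ _ this h.close
  omega

lemma E2 {c : ℕ → V} {L : ℕ} (h : Cyc_s2 G c L) (hm : IsMaxL G L) {p1 p2 p3 p4 k k' : ℕ} {K K' : Set V}
    (h12 : p1 < p2) (h23 : p2 < p3) (h34 : p3 < p4) (h4 : p4 < L)
    (hK : Disjoint K (c '' Set.Iio L)) (hK' : Disjoint K' (c '' Set.Iio L))
    (hKK : Disjoint K K')
    (hC : Conn G K (c p1) (c p3) k) (hC' : Conn G K' (c p2) (c p4) k') :
    k + k' + 2 ≤ (p2 - p1) + (p4 - p3) := by
  have := (h.seg (Nat.zero_le p1) (by omega)).join hC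
    ((h.seg (show p2 ≤ p3 by omega) (by omega)).symm)
    (subL hK (by omega)).symm (h.segdisj (by omega) (by omega)) (subL hK (by omega))
  have := this.join hC' (h.seg (show p4 ≤ L - 1 by omega) (by omega))
    (by
      simp only [Set.disjoint_union_left]
      exact ⟨⟨(subL hK' (by omega)).symm, hKK⟩, (subL hK' (by omega)).symm⟩)
    (by
      simp only [Set.disjoint_union_left]
      exact ⟨⟨h.segdisj (by omega) (by omega), subL hK (by omega)⟩, h.segdisj (by omega) (by omega)⟩)
    (subL hK' (by omega))
  have := hm _ _ _ _ this h.close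
  omega

lemma E3 {c : ℕ → V} {L : ℕ} (h : Cyc_s2 G c L) (hm : IsMaxL G L)
    {p1 p2 p3 p4 p5 p6 p7 p8 k1 k2 k3 k4 : ℕ} {K1 K2 K3 K4 : Set V}
    (h12 : p1 < p2) (h23 : p2 < p3) (h34 : p3 < p4) (h45 : p4 < p5) (h56 : p5 < p6)
    (h67 : p6 < p7) (h78 : p7 < p8) (h8 : p8 < L)
    (hK1 : Disjoint K1 (c '' Set.Iio L)) (hK2 : Disjoint K2 (c '' Set.Iio L))
    (hK3 : Disjoint K3 (c '' Set.Iio L)) (hK4 : Disjoint K4 (c '' Set.Iio L))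
    (h'12 : Disjoint K1 K2) (h'13 : Disjoint K1 K3) (h'14 : Disjoint K1 K4)
    (h'23 : Disjoint K2 K3) (h'24 : Disjoint K2 K4) (h'34 : Disjoint K3 K4)
    (hC1 : Conn G K1 (c p1) (c p3) k1) (hC2 : Conn G K2 (c p2) (c p4) k2)
    (hC3 : Conn G K3 (c p5) (c p7) k3) (hC4 : Conn G K4 (c p6) (c p8) k4) :
    k1 + k2 + k3 + k4 + 4 ≤ (p2 - p1) + (p4 - p3) + (p6 - p5) + (p8 - p7) := by
  have := (h.seg (Nat.zero_le p1) (by omega)).join hC1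
    ((h.seg (show p2 ≤ p3 by omega) (by omega)).symm)
    (subL hK1 (by omega)).symm (h.segdisj (by omega) (by omega)) (subL hK1 (by omega))
  have := this.join hC2 (h.seg (show p4 ≤ p5 by omega) (by omega))
    (by
      simp only [Set.disjoint_union_left]
      exact ⟨⟨(subL hK2 (by omega)).symm, h'12⟩, (subL hK2 (by omega)).symm⟩)
    (by
      simp only [Set.disjoint_union_left]
      exact ⟨⟨h.segdisj (by omega) (by omega), subL hK1 (by omega)⟩, h.segdisj (by omega) (by omega)⟩)
    (subL hK2 (by omega))
  have := this.join hC3 (h.seg (show p6 ≤ p7 by omega) (by omega)).symm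
    (by
      simp only [Set.disjoint_union_left]
      exact ⟨⟨⟨⟨(subL hK3 (by omega)).symm, h'13⟩, (subL hK3 (by omega)).symm⟩, h'23⟩, (subL hK3 (by omega)).symm⟩)
    (by
      simp only [Set.disjoint_union_left]
      exact ⟨⟨⟨⟨h.segdisj (by omega) (by omega), subL hK1 (by omega)⟩, h.segdisj (by omega) (by omega)⟩,
        subL hK2 (by omega)⟩, h.segdisj (by omega) (by omega)⟩)
    (subL hK3 (by omega))
  have := this.join hC4 (h.seg (show p8 ≤ L - 1 by omega) (by omega))
    (by
      simp only [Set.disjoint_union_left]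
      exact ⟨⟨⟨⟨⟨⟨(subL hK4 (by omega)).symm, h'14⟩, (subL hK4 (by omega)).symm⟩, h'24⟩, (subL hK4 (by omega)).symm⟩, h'34⟩,
        (subL hK4 (by omega)).symm⟩)
    (by
      simp only [Set.disjoint_union_left]
      exact ⟨⟨⟨⟨⟨⟨h.segdisj (by omega) (by omega), subL hK1 (by omega)⟩, h.segdisj (by omega) (by omega)⟩,
        subL hK2 (by omega)⟩, h.segdisj (by omega) (by omega)⟩, subL hK3 (by omega)⟩, h.segdisj (by omega) (by omega)⟩)
    (subL hK4 (by omega))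
  have := hm _ _ _ _ this h.close
  omega

lemma E4 {c : ℕ → V} {L : ℕ} (h : Cyc_s2 G c L) (hm : IsMaxL G L)
    {p1 p2 p3 p4 p5 p6 p7 p8 k1 k2 k3 k4 : ℕ} {K1 K2 K3 K4 : Set V}
    (h12 : p1 < p2) (h23 : p2 < p3) (h34 : p3 < p4) (h45 : p4 < p5) (h56 : p5 < p6)
    (h67 : p6 < p7) (h78 : p7 < p8) (h8 : p8 < L)
    (hK1 : Disjoint K1 (c '' Set.Iio L)) (hK2 : Disjoint K2 (c '' Set.Iio L))
    (hK3 : Disjoint K3 (c '' Set.Iio L)) (hK4 : Disjoint K4 (c '' Set.Iio L))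
    (h'12 : Disjoint K1 K2) (h'13 : Disjoint K1 K3) (h'14 : Disjoint K1 K4)
    (h'23 : Disjoint K2 K3) (h'24 : Disjoint K2 K4) (h'34 : Disjoint K3 K4)
    (hC1 : Conn G K1 (c p1) (c p6) k1) (hC2 : Conn G K2 (c p7) (c p4) k2)
    (hC3 : Conn G K3 (c p5) (c p2) k3) (hC4 : Conn G K4 (c p3) (c p8) k4) :
    k1 + k2 + k3 + k4 + 4 ≤ (p2 - p1) + (p4 - p3) + (p6 - p5) + (p8 - p7) := by
  have := (h.seg (Nat.zero_le p1) (by omega)).join hC1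
    ((h.seg (show p6 ≤ p7 by omega) (by omega)))
    (subL hK1 (by omega)).symm (h.segdisj (by omega) (by omega)) (subL hK1 (by omega))
  have := this.join hC2 (h.seg (show p4 ≤ p5 by omega) (by omega))
    (by
      simp only [Set.disjoint_union_left]
      exact ⟨⟨(subL hK2 (by omega)).symm, h'12⟩, (subL hK2 (by omega)).symm⟩)
    (by
      simp only [Set.disjoint_union_left]
      exact ⟨⟨h.segdisj (by omega) (by omega), subL hK1 (by omega)⟩, (h.segdisj (by omega) (by omega)).symm⟩)
    (subL hK2 (by omega))
  have := this.join hC3 (h.seg (show p2 ≤ p3 by omega) (by omega))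
    (by
      simp only [Set.disjoint_union_left]
      exact ⟨⟨⟨⟨(subL hK3 (by omega)).symm, h'13⟩, (subL hK3 (by omega)).symm⟩, h'23⟩, (subL hK3 (by omega)).symm⟩)
    (by
      simp only [Set.disjoint_union_left]
      exact ⟨⟨⟨⟨h.segdisj (by omega) (by omega), subL hK1 (by omega)⟩, (h.segdisj (by omega) (by omega)).symm⟩,
        subL hK2 (by omega)⟩, (h.segdisj (by omega) (by omega)).symm⟩)
    (subL hK3 (by omega))
  have := this.join hC4 (h.seg (show p8 ≤ L - 1 by omega) (by omega))
    (by
      simp only [Set.disjoint_union_left]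
      exact ⟨⟨⟨⟨⟨⟨(subL hK4 (by omega)).symm, h'14⟩, (subL hK4 (by omega)).symm⟩, h'24⟩, (subL hK4 (by omega)).symm⟩, h'34⟩,
        (subL hK4 (by omega)).symm⟩)
    (by
      simp only [Set.disjoint_union_left]
      exact ⟨⟨⟨⟨⟨⟨h.segdisj (by omega) (by omega), subL hK1 (by omega)⟩, h.segdisj (by omega) (by omega)⟩,
        subL hK2 (by omega)⟩, h.segdisj (by omega) (by omega)⟩, subL hK3 (by omega)⟩, h.segdisj (by omega) (by omega)⟩)
    (subL hK4 (by omega))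
  have := hm _ _ _ _ this h.close
  omega

def ds (a b : ℕ) : ℕ := (a - b) + (b - a)

structure Config {ι : Type} (G : SimpleGraph V) (c c' : ℕ → V) (L : ℕ) (p q : ι → ℕ) (T : ι → Set V)
    (s s' : ℕ → ℕ) : Prop where
  hc : Cyc_s2 G c L
  hc' : Cyc_s2 G c' L
  hm : IsMaxL G L
  hp : ∀ e, p e < L
  hq : ∀ e, q e < L
  pinj : Function.Injective p
  qinj : Function.Injective q
  Tc : ∀ e, Disjoint (T e) (c '' Set.Iio L)
  Tc' : ∀ e, Disjoint (T e) (c' '' Set.Iio L)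
  TT : ∀ e f, e ≠ f → Disjoint (T e) (T f)
  conn : ∀ e, Conn G (T e) (c (p e)) (c' (q e)) 0
  smono : Monotone s
  smono' : Monotone s'
  sep : ∀ e f r, s (p e) = s (p f) → p e ≤ r → r ≤ p f → c r ∉ c' '' Set.Iio L
  sep' : ∀ e f r, s' (q e) = s' (q f) → q e ≤ r → r ≤ q f → c' r ∉ c '' Set.Iio L

variable {ι : Type} {c c' : ℕ → V} {L : ℕ} {p q : ι → ℕ} {T : ι → Set V} {s s' : ℕ → ℕ}

lemma Config.swap (h : Config G c c' L p q T s s') : Config G c' c L q p T s' s :=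
  ⟨h.hc', h.hc, h.hm, h.hq, h.hp, h.qinj, h.pinj, h.Tc', h.Tc, h.TT, fun e => (h.conn e).symm,
    h.smono', h.smono, h.sep', h.sep⟩

def KK (c' : ℕ → V) (q : ι → ℕ) (T : ι → Set V) (e f : ι) : Set V :=
  T e ∪ c' '' Set.Icc (min (q e) (q f)) (max (q e) (q f)) ∪ T f

lemma Config.kconn (h : Config G c c' L p q T s s') {e f : ι} (hef : e ≠ f)
    (hs : s' (q e) = s' (q f)) :
    Conn G (KK c' q T e f) (c (p e)) (c (p f)) (ds (q e) (q f) + 1) := by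
  have hlt : max (q e) (q f) < L := max_lt (h.hq e) (h.hq f)
  have key : PE G (c' '' Set.Icc (min (q e) (q f)) (max (q e) (q f))) (c' (q e)) (c' (q f))
      (ds (q e) (q f) + 1) := by
    rcases le_total (q e) (q f) with hl | hl
    · have := h.hc'.seg hl (h.hq f)
      rw [min_eq_left hl, max_eq_right hl]
      convert this using 2
      unfold ds; omega
    · have := (h.hc'.seg hl (h.hq e)).symm
      rw [min_eq_right hl, max_eq_left hl]
      convert this using 2
      unfold ds; omega
  exact Conn.join (h.conn e) key (h.conn f) (subL (h.Tc' e) hlt) (h.TT e f hef)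
    (subL (h.Tc' f) hlt).symm

lemma Config.kdisj (h : Config G c c' L p q T s s') {e f : ι}
    (hs : s' (q e) = s' (q f)) : Disjoint (KK c' q T e f) (c '' Set.Iio L) := by
  unfold KK
  simp only [Set.disjoint_union_left]
  refine ⟨⟨h.Tc e, ?_⟩, h.Tc f⟩
  rw [Set.disjoint_left]
  rintro _ ⟨r, ⟨hr1, hr2⟩, rfl⟩
  rcases le_total (q e) (q f) with hl | hl
  · rw [min_eq_left hl] at hr1
    rw [max_eq_right hl] at hr2
    exact h.sep' e f r hs hr1 hr2
  · rw [min_eq_right hl] at hr1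
    rw [max_eq_left hl] at hr2
    exact h.sep' f e r hs.symm hr1 hr2

lemma Config.kkdisj (h : Config G c c' L p q T s s') {e f e' f' : ι}
    (hs : s' (q e) = s' (q f)) (hs' : s' (q e') = s' (q f')) (hne : s' (q e) ≠ s' (q e')) :
    Disjoint (KK c' q T e f) (KK c' q T e' f') := by
  have n1 : e ≠ e' := by rintro rfl; exact hne rfl
  have n2 : e ≠ f' := by rintro rfl; exact hne hs'.symm
  have n3 : f ≠ e' := by rintro rfl; exact hne hs
  have n4 : f ≠ f' := by rintro rfl; exact hne (hs.trans hs'.symm)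
  have b1 : max (q e) (q f) < L := max_lt (h.hq e) (h.hq f)
  have b2 : max (q e') (q f') < L := max_lt (h.hq e') (h.hq f')
  have key : ∀ e f r, s' (q e) = s' (q f) → r ∈ Set.Icc (min (q e) (q f)) (max (q e) (q f)) →
      s' r = s' (q e) := by
    rintro e f r hs ⟨h1, h2⟩
    rcases le_total (q e) (q f) with hl | hl
    · rw [min_eq_left hl] at h1
      rw [max_eq_right hl] at h2
      exact le_antisymm (hs ▸ h.smono' h2) (h.smono' h1)
    · rw [min_eq_right hl] at h1
      rw [max_eq_left hl] at h2
      exact le_antisymm (h.smono' h2) (hs ▸ h.smono' h1)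
  unfold KK
  simp only [Set.disjoint_union_left, Set.disjoint_union_right]
  refine ⟨⟨⟨⟨h.TT _ _ n1, (subL (h.Tc' _) b1).symm⟩, h.TT _ _ n3⟩,
    ⟨⟨subL (h.Tc' _) b2, ?_⟩, subL (h.Tc' _) b2⟩⟩, ⟨⟨h.TT _ _ n2, (subL (h.Tc' _) b1).symm⟩, h.TT _ _ n4⟩⟩
  rw [Set.disjoint_left]
  rintro _ ⟨r, hr, rfl⟩ ⟨r', hr', he⟩
  have : r' = r := h.hc'.inj (lt_of_le_of_lt hr'.2 b2) (lt_of_le_of_lt hr.2 b1) he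
  subst this
  exact hne ((key _ _ _ hs hr).symm.trans (key _ _ _ hs' hr'))

lemma Config.E1c (h : Config G c c' L p q T s s') {e f : ι} (hef : e ≠ f)
    (hs : s' (q e) = s' (q f)) : ds (q e) (q f) < ds (p e) (p f) := by
  rcases lt_trichotomy (p e) (p f) with hl | hl | hl
  · have := E1 h.hc h.hm hl (h.hp f) (h.kdisj hs) (h.kconn hef hs)
    unfold ds at *; omega
  · exact absurd (h.pinj hl) hef
  · have := E1 h.hc h.hm hl (h.hp e) (h.kdisj hs.symm) (h.kconn hef.symm hs.symm)
    unfold ds at *; omega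

lemma Config.inj (h : Config G c c' L p q T s s') {e f : ι} (h1 : s (p e) = s (p f))
    (h2 : s' (q e) = s' (q f)) : e = f := by
  by_contra hef
  have := h.E1c hef h2
  have := h.swap.E1c hef h1
  omega

lemma ne_of {p : ι → ℕ} {e f : ι} (h : p e < p f) : e ≠ f := by
  rintro rfl; omega

lemma Config.E2c (h : Config G c c' L p q T s s') {e1 e2 e3 e4 : ι}
    (h12 : p e1 < p e2) (h23 : p e2 < p e3) (h34 : p e3 < p e4)
    (s13 : s' (q e1) = s' (q e3)) (s24 : s' (q e2) = s' (q e4)) (hne : s' (q e1) ≠ s' (q e2)) :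
    ds (q e1) (q e3) + ds (q e2) (q e4) < ds (p e1) (p e2) + ds (p e3) (p e4) := by
  have := E2 h.hc h.hm h12 h23 h34 (h.hp _) (h.kdisj s13) (h.kdisj s24) (h.kkdisj s13 s24 hne)
    (h.kconn (ne_of (h12.trans h23)) s13) (h.kconn (ne_of (h23.trans h34)) s24)
  unfold ds at *; omega

lemma Config.E3c (h : Config G c c' L p q T s s') {e1 e2 e3 e4 e5 e6 e7 e8 : ι}
    (h12 : p e1 < p e2) (h23 : p e2 < p e3) (h34 : p e3 < p e4) (h45 : p e4 < p e5)
    (h56 : p e5 < p e6) (h67 : p e6 < p e7) (h78 : p e7 < p e8)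
    (s1 : s' (q e1) = s' (q e3)) (s2 : s' (q e2) = s' (q e4))
    (s3 : s' (q e5) = s' (q e7)) (s4 : s' (q e6) = s' (q e8))
    (n12 : s' (q e1) ≠ s' (q e2)) (n13 : s' (q e1) ≠ s' (q e5)) (n14 : s' (q e1) ≠ s' (q e6))
    (n23 : s' (q e2) ≠ s' (q e5)) (n24 : s' (q e2) ≠ s' (q e6)) (n34 : s' (q e5) ≠ s' (q e6)) :
    ds (q e1) (q e3) + ds (q e2) (q e4) + ds (q e5) (q e7) + ds (q e6) (q e8) <
      ds (p e1) (p e2) + ds (p e3) (p e4) + ds (p e5) (p e6) + ds (p e7) (p e8) := by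
  have := E3 h.hc h.hm h12 h23 h34 h45 h56 h67 h78 (h.hp _)
    (h.kdisj s1) (h.kdisj s2) (h.kdisj s3) (h.kdisj s4)
    (h.kkdisj s1 s2 n12) (h.kkdisj s1 s3 n13) (h.kkdisj s1 s4 n14)
    (h.kkdisj s2 s3 n23) (h.kkdisj s2 s4 n24) (h.kkdisj s3 s4 n34)
    (h.kconn (ne_of (h12.trans h23)) s1) (h.kconn (ne_of (h23.trans h34)) s2)
    (h.kconn (ne_of (h56.trans h67)) s3) (h.kconn (ne_of (h67.trans h78)) s4)
  unfold ds at *; omega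

lemma Config.E4c (h : Config G c c' L p q T s s') {e1 e2 e3 e4 e5 e6 e7 e8 : ι}
    (h12 : p e1 < p e2) (h23 : p e2 < p e3) (h34 : p e3 < p e4) (h45 : p e4 < p e5)
    (h56 : p e5 < p e6) (h67 : p e6 < p e7) (h78 : p e7 < p e8)
    (s1 : s' (q e1) = s' (q e6)) (s2 : s' (q e7) = s' (q e4))
    (s3 : s' (q e5) = s' (q e2)) (s4 : s' (q e3) = s' (q e8))
    (n12 : s' (q e1) ≠ s' (q e7)) (n13 : s' (q e1) ≠ s' (q e5)) (n14 : s' (q e1) ≠ s' (q e3))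
    (n23 : s' (q e7) ≠ s' (q e5)) (n24 : s' (q e7) ≠ s' (q e3)) (n34 : s' (q e5) ≠ s' (q e3)) :
    ds (q e1) (q e6) + ds (q e2) (q e5) + ds (q e4) (q e7) + ds (q e3) (q e8) <
      ds (p e1) (p e2) + ds (p e3) (p e4) + ds (p e5) (p e6) + ds (p e7) (p e8) := by
  have := E4 h.hc h.hm h12 h23 h34 h45 h56 h67 h78 (h.hp _)
    (h.kdisj s1) (h.kdisj s2) (h.kdisj s3) (h.kdisj s4)
    (h.kkdisj s1 s2 n12) (h.kkdisj s1 s3 n13) (h.kkdisj s1 s4 n14)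
    (h.kkdisj s2 s3 n23) (h.kkdisj s2 s4 n24) (h.kkdisj s3 s4 n34)
    (h.kconn (by rintro rfl; omega) s1) (h.kconn (by rintro rfl; omega) s2)
    (h.kconn (by rintro rfl; omega) s3) (h.kconn (by rintro rfl; omega) s4)
  unfold ds at *; omega

lemma ds_comm (a b : ℕ) : ds a b = ds b a := by unfold ds; omega

lemma Config.lt (h : Config G c c' L p q T s s') {e f : ι} (hs : s (p e) < s (p f)) : p e < p f := by
  by_contra hh
  have := h.smono (not_lt.1 hh)
  omega

lemma Config.P2 (h : Config G c c' L p q T s s') {a b a2 b2 : ι}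
    (hab : s (p a) = s (p b)) (hab2 : s (p a2) = s (p b2)) (hik : s (p a) < s (p a2))
    (ha : s' (q a) = s' (q a2)) (hb : s' (q b) = s' (q b2)) (hj : s' (q a) ≠ s' (q b))
    (hpar : p a < p b ↔ p a2 < p b2) :
    ds (q a) (q a2) + ds (q b) (q b2) < ds (p a) (p b) + ds (p a2) (p b2) := by
  have nab : p a ≠ p b := fun hh => hj (by rw [h.pinj hh])
  have nab2 : p a2 ≠ p b2 := fun hh => hj (by rw [ha, hb, h.pinj hh])
  by_cases hl : p a < p b
  · exact h.E2c hl (h.lt (by omega)) (hpar.1 hl) ha hb hj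
  · have hl2 : ¬ p a2 < p b2 := fun hh => hl (hpar.2 hh)
    have := h.E2c (e1 := b) (e2 := a) (e3 := b2) (e4 := a2) (by omega) (h.lt (by omega)) (by omega)
      hb ha hj.symm
    rw [ds_comm (p b), ds_comm (p b2)] at this
    omega

lemma Config.bad (h : Config G c c' L p q T s s') {a b a2 b2 : ι}
    (hab : s (p a) = s (p b)) (hab2 : s (p a2) = s (p b2)) (hik : s (p a) < s (p a2))
    (ha : s' (q a) = s' (q a2)) (hb : s' (q b) = s' (q b2)) (hj : s' (q a) < s' (q b))
    (hpar : q a < q a2 ↔ q b < q b2) : ¬ (p a < p b ↔ p a2 < p b2) := by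
  intro hh
  have := h.P2 hab hab2 hik ha hb hj.ne hh
  have := h.swap.P2 ha hb hj hab hab2 hik.ne hpar
  omega

lemma Config.dpar (h : Config G c c' L p q T s s') {a b a2 b2 e f e2 f2 : ι}
    (hab : s (p a) = s (p b)) (hab2 : s (p a2) = s (p b2)) (hef : s (p e) = s (p f))
    (hef2 : s (p e2) = s (p f2)) (h1 : s (p a) < s (p a2)) (h2 : s (p a2) < s (p e))
    (h3 : s (p e) < s (p e2))
    (ha : s' (q a) = s' (q a2)) (hb : s' (q b) = s' (q b2))
    (he : s' (q e) = s' (q e2)) (hf : s' (q f) = s' (q f2))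
    (n12 : s' (q a) ≠ s' (q b)) (n13 : s' (q a) ≠ s' (q e)) (n14 : s' (q a) ≠ s' (q f))
    (n23 : s' (q b) ≠ s' (q e)) (n24 : s' (q b) ≠ s' (q f)) (n34 : s' (q e) ≠ s' (q f))
    (hpar : p a < p b ↔ p a2 < p b2) (hpar' : p e < p f ↔ p e2 < p f2) :
    ds (q a) (q a2) + ds (q b) (q b2) + ds (q e) (q e2) + ds (q f) (q f2) <
     ds (p a) (p b) + ds (p a2) (p b2) + ds (p e) (p f) + ds (p e2) (p f2) := by
  have nab : p a ≠ p b := fun hh => n12 (by rw [h.pinj hh])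
  have nab2 : p a2 ≠ p b2 := fun hh => n12 (by rw [ha, hb, h.pinj hh])
  have nef : p e ≠ p f := fun hh => n34 (by rw [h.pinj hh])
  have nef2 : p e2 ≠ p f2 := fun hh => n34 (by rw [he, hf, h.pinj hh])
  have c1 := ds_comm (p a) (p b)
  have c2 := ds_comm (p a2) (p b2)
  have c3 := ds_comm (p e) (p f)
  have c4 := ds_comm (p e2) (p f2)
  by_cases hl : p a < p b
  · have hl2 := hpar.1 hl
    by_cases hm : p e < p f
    · have hm2 := hpar'.1 hm
      exact h.E3c hl (h.lt (by omega)) hl2 (h.lt (by omega)) hm (h.lt (by omega)) hm2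
        ha hb he hf n12 n13 n14 n23 n24 n34
    · have hm2 : ¬ p e2 < p f2 := fun hh => hm (hpar'.2 hh)
      have := h.E3c hl (h.lt (by omega)) hl2 (h.lt (by omega)) (show p f < p e by omega)
        (h.lt (by omega)) (show p f2 < p e2 by omega)
        ha hb hf he n12 n14 n13 n24 n23 n34.symm
      omega
  · have hl2 : ¬ p a2 < p b2 := fun hh => hl (hpar.2 hh)
    by_cases hm : p e < p f
    · have hm2 := hpar'.1 hm
      have := h.E3c (show p b < p a by omega) (h.lt (by omega)) (show p b2 < p a2 by omega)
        (h.lt (by omega)) hm (h.lt (by omega)) hm2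
        hb ha he hf n12.symm n23 n24 n13 n14 n34
      omega
    · have hm2 : ¬ p e2 < p f2 := fun hh => hm (hpar'.2 hh)
      have := h.E3c (show p b < p a by omega) (h.lt (by omega)) (show p b2 < p a2 by omega)
        (h.lt (by omega)) (show p f < p e by omega)
        (h.lt (by omega)) (show p f2 < p e2 by omega)
        hb ha hf he n12.symm n24 n23 n14 n13 n34.symm
      omega

lemma Config.dcross (h : Config G c c' L p q T s s') {a b a2 b2 e f e2 f2 : ι}
    (hab : s (p a) = s (p b)) (hab2 : s (p a2) = s (p b2)) (hef : s (p e) = s (p f))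
    (hef2 : s (p e2) = s (p f2)) (h1 : s (p a) < s (p e)) (h2 : s (p e) < s (p a2))
    (h3 : s (p a2) < s (p e2))
    (ha : s' (q a) = s' (q a2)) (hb : s' (q b) = s' (q b2))
    (he : s' (q e) = s' (q e2)) (hf : s' (q f) = s' (q f2))
    (n12 : s' (q a) ≠ s' (q b)) (n13 : s' (q a) ≠ s' (q e)) (n14 : s' (q a) ≠ s' (q f))
    (n23 : s' (q b) ≠ s' (q e)) (n24 : s' (q b) ≠ s' (q f)) (n34 : s' (q e) ≠ s' (q f))
    (hpar : ¬ (p a < p b ↔ p a2 < p b2)) (hpar' : ¬ (p e < p f ↔ p e2 < p f2)) :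
    ds (q a) (q a2) + ds (q b) (q b2) + ds (q e) (q e2) + ds (q f) (q f2) <
     ds (p a) (p b) + ds (p a2) (p b2) + ds (p e) (p f) + ds (p e2) (p f2) := by
  have nab : p a ≠ p b := fun hh => n12 (by rw [h.pinj hh])
  have nab2 : p a2 ≠ p b2 := fun hh => n12 (by rw [ha, hb, h.pinj hh])
  have nef : p e ≠ p f := fun hh => n34 (by rw [h.pinj hh])
  have nef2 : p e2 ≠ p f2 := fun hh => n34 (by rw [he, hf, h.pinj hh])
  have c1 := ds_comm (p a) (p b)
  have c2 := ds_comm (p a2) (p b2)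
  have c3 := ds_comm (p e) (p f)
  have c4 := ds_comm (p e2) (p f2)
  -- generic call
  have call : ∀ x y x2 y2 z w z2 w2 : ι, p x < p y → p y2 < p x2 → p z < p w → p w2 < p z2 →
      s (p y) < s (p z) → s (p w) < s (p y2) → s (p x2) < s (p w2) →
      s' (q x) = s' (q x2) → s' (q y) = s' (q y2) → s' (q z) = s' (q z2) → s' (q w) = s' (q w2) →
      s' (q x) ≠ s' (q y) → s' (q x) ≠ s' (q z) → s' (q x) ≠ s' (q w) →
      s' (q y) ≠ s' (q z) → s' (q y) ≠ s' (q w) → s' (q z) ≠ s' (q w) →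
      ds (q x) (q x2) + ds (q y) (q y2) + ds (q w) (q w2) + ds (q z) (q z2) <
      ds (p x) (p y) + ds (p z) (p w) + ds (p y2) (p x2) + ds (p w2) (p z2) := by
    intro x y x2 y2 z w z2 w2 o1 o2 o3 o4 o5 o6 o7 t1 t2 t3 t4 m1 m2 m3 m4 m5 m6
    exact h.E4c o1 (h.lt o5) o3 (h.lt o6) o2 (h.lt o7) o4 t1 t4.symm t2.symm t3
      (by omega) (by omega) (by omega) (by omega) (by omega) (by omega)
  by_cases hl : p a < p b
  · have hl2 : ¬ p a2 < p b2 := by tauto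
    by_cases hm : p e < p f
    · have hm2 : ¬ p e2 < p f2 := by tauto
      have := call a b a2 b2 e f e2 f2 (by omega) (by omega) (by omega) (by omega) (by omega)
        (by omega) (by omega) ha hb he hf (by omega) (by omega) (by omega) (by omega) (by omega) (by omega)
      omega
    · have hm2 : p e2 < p f2 := by tauto
      have := call a b a2 b2 f e f2 e2 (by omega) (by omega) (by omega) (by omega) (by omega)
        (by omega) (by omega) ha hb hf he (by omega) (by omega) (by omega) (by omega) (by omega) (by omega)
      omega
  · have hl2 : p a2 < p b2 := by tauto
    by_cases hm : p e < p f
    · have hm2 : ¬ p e2 < p f2 := by tauto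
      have := call b a b2 a2 e f e2 f2 (by omega) (by omega) (by omega) (by omega) (by omega)
        (by omega) (by omega) hb ha he hf (by omega) (by omega) (by omega) (by omega) (by omega) (by omega)
      omega
    · have hm2 : p e2 < p f2 := by tauto
      have := call b a b2 a2 f e f2 e2 (by omega) (by omega) (by omega) (by omega) (by omega)
        (by omega) (by omega) hb ha hf he (by omega) (by omega) (by omega) (by omega) (by omega) (by omega)
      omega

/-- Two crossing heavy pairs with separated parallel choices are impossible (first order). -/
lemma Config.no_cross (h : Config G c c' L p q T s s') {a b a2 b2 e f e2 f2 : ι}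
    (hab : s (p a) = s (p b)) (hab2 : s (p a2) = s (p b2)) (hef : s (p e) = s (p f))
    (hef2 : s (p e2) = s (p f2)) (h1 : s (p a) < s (p e)) (h2 : s (p e) < s (p a2))
    (h3 : s (p a2) < s (p e2))
    (ha : s' (q a) = s' (q a2)) (hb : s' (q b) = s' (q b2))
    (he : s' (q e) = s' (q e2)) (hf : s' (q f) = s' (q f2))
    (hj : s' (q a) < s' (q b)) (hg : s' (q e) < s' (q f))
    (hjg : s' (q b) < s' (q e) ∨ s' (q f) < s' (q a))
    (hpar : q a < q a2 ↔ q b < q b2) (hpar' : q e < q e2 ↔ q f < q f2) : False := by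
  have B1 := h.bad hab hab2 (by omega) ha hb hj hpar
  have B2 := h.bad hef hef2 (by omega) he hf hg hpar'
  have X := h.dcross hab hab2 hef hef2 h1 h2 h3 ha hb he hf (by omega) (by omega) (by omega)
    (by omega) (by omega) (by omega) B1 B2
  rcases hjg with hjg | hjg
  · have := h.swap.dpar (a := a) (b := a2) (a2 := b) (b2 := b2) (e := e) (f := e2) (e2 := f)
      (f2 := f2) ha hb he hf hj hjg hg hab hab2 hef hef2 (by omega) (by omega) (by omega)
      (by omega) (by omega) (by omega) hpar hpar'
    omega
  · have := h.swap.dpar (a := e) (b := e2) (a2 := f) (b2 := f2) (e := a) (f := a2) (e2 := b)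
      (f2 := b2) he hf ha hb hg hjg hj hef hef2 hab hab2 (by omega) (by omega) (by omega)
      (by omega) (by omega) (by omega) hpar' hpar
    omega

lemma two_of_three (P : ℕ → Prop) {x y z : ℕ} (hxy : x < y) (hyz : y < z) :
    ∃ j j', (j = x ∨ j = y ∨ j = z) ∧ (j' = x ∨ j' = y ∨ j' = z) ∧ j < j' ∧ (P j ↔ P j') := by
  by_cases h1 : P x ↔ P y
  · exact ⟨x, y, by simp, by simp, hxy, h1⟩
  by_cases h2 : P y ↔ P z
  · exact ⟨y, z, by simp, by simp, hyz, h2⟩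
  exact ⟨x, z, by simp, by simp, hxy.trans hyz, by tauto⟩

lemma six {A : Finset ℕ} (hA : 6 ≤ A.card) : ∃ α : Fin 6 → ℕ, StrictMono α ∧ ∀ i, α i ∈ A := by
  obtain ⟨A', hA', hc⟩ := Finset.exists_subset_card_eq hA
  exact ⟨A'.orderEmbOfFin hc, (A'.orderEmbOfFin hc).strictMono,
    fun i => hA' (A'.orderEmbOfFin_mem hc i)⟩

lemma pick {A B : Finset ℕ} (hA : 6 ≤ A.card) (hB : 6 ≤ B.card) (P Q : ℕ → Prop) :
    ∃ j j' g g', j ∈ A ∧ j' ∈ A ∧ g ∈ B ∧ g' ∈ B ∧ j < j' ∧ g < g' ∧ (j' < g ∨ g' < j) ∧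
      (P j ↔ P j') ∧ (Q g ↔ Q g') := by
  obtain ⟨α, hα, hαA⟩ := six hA
  obtain ⟨β, hβ, hβB⟩ := six hB
  have a01 : α 0 < α 1 := hα (by decide)
  have a12 : α 1 < α 2 := hα (by decide)
  have a23 : α 2 < α 3 := hα (by decide)
  have a34 : α 3 < α 4 := hα (by decide)
  have a45 : α 4 < α 5 := hα (by decide)
  have b01 : β 0 < β 1 := hβ (by decide)
  have b12 : β 1 < β 2 := hβ (by decide)
  have b23 : β 2 < β 3 := hβ (by decide)
  have b34 : β 3 < β 4 := hβ (by decide)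
  have b45 : β 4 < β 5 := hβ (by decide)
  by_cases h : α 2 < β 3
  · obtain ⟨j, j', h1, h2, h3, h4⟩ := two_of_three P a01 a12
    obtain ⟨g, g', k1, k2, k3, k4⟩ := two_of_three Q b34 b45
    refine ⟨j, j', g, g', ?_, ?_, ?_, ?_, h3, k3, Or.inl ?_, h4, k4⟩
    · rcases h1 with rfl | rfl | rfl <;> exact hαA _
    · rcases h2 with rfl | rfl | rfl <;> exact hαA _
    · rcases k1 with rfl | rfl | rfl <;> exact hβB _
    · rcases k2 with rfl | rfl | rfl <;> exact hβB _
    · omega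
  · obtain ⟨j, j', h1, h2, h3, h4⟩ := two_of_three P a34 a45
    obtain ⟨g, g', k1, k2, k3, k4⟩ := two_of_three Q b01 b12
    refine ⟨j, j', g, g', ?_, ?_, ?_, ?_, h3, k3, Or.inr ?_, h4, k4⟩
    · rcases h1 with rfl | rfl | rfl <;> exact hαA _
    · rcases h2 with rfl | rfl | rfl <;> exact hαA _
    · rcases k1 with rfl | rfl | rfl <;> exact hβB _
    · rcases k2 with rfl | rfl | rfl <;> exact hβB _
    · omega

lemma outer {M : ℕ} {E : Finset (ℕ × ℕ)} (hE : ∀ x ∈ E, x.1 < x.2 ∧ x.2 < M)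
    (hnc : ∀ x ∈ E, ∀ y ∈ E, x.1 < y.1 → y.1 < x.2 → x.2 < y.2 → False) : E.card ≤ 2 * M := by
  classical
  let F := E.filter (fun x => ∃ y ∈ E, y.1 = x.1 ∧ x.2 < y.2)
  have h1 : F.card ≤ M := by
    rw [← Finset.card_range M]
    apply Finset.card_le_card_of_injOn (fun x => x.2)
    · intro x hx
      simp only [F, Finset.coe_filter, Set.mem_ofPred_eq] at hx
      simpa using (hE x hx.1).2
    · have key : ∀ x ∈ F, ∀ y ∈ F, x.2 = y.2 → ¬ x.1 < y.1 := by
        intro x hx y hy hxy hl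
        simp only [F, Finset.mem_filter] at hx hy
        obtain ⟨hy, z, hz, hz1, hz2⟩ := hy
        have := hE y hy
        exact hnc x hx.1 z hz (by omega) (by omega) (by omega)
      intro x hx y hy hxy
      have k1 := key x hx y hy hxy
      have k2 := key y hy x hx hxy.symm
      exact Prod.ext (by omega) hxy
  have h2 : (E \ F).card ≤ M := by
    rw [← Finset.card_range M]
    apply Finset.card_le_card_of_injOn (fun x => x.1)
    · intro x hx
      simp only [Finset.coe_sdiff, Set.mem_sdiff, Finset.mem_coe] at hx
      have := hE x hx.1
      simp; omega
    · have key : ∀ x ∈ E \ F, ∀ y ∈ E \ F, x.1 = y.1 → ¬ x.2 < y.2 := by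
        intro x hx y hy hxy hl
        simp only [F, Finset.mem_sdiff, Finset.mem_filter] at hx hy
        exact hx.2 ⟨hx.1, y, hy.1, hxy.symm, hl⟩
      intro x hx y hy hxy
      have k1 := key x hx y hy hxy
      have k2 := key y hy x hx hxy.symm
      exact Prod.ext hxy (by omega)
  have : E.card ≤ (E \ F).card + F.card := by
    rw [Finset.card_sdiff_add_card_eq_card (Finset.filter_subset _ _)]
  omega

lemma count {M : ℕ} {H : Finset (ℕ × ℕ)} (hH : ∀ x ∈ H, x.1 < M ∧ x.2 < M)
    (hnc : ∀ i i2 k k2, i < i2 → i2 < k → k < k2 →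
      6 ≤ ((Finset.range M).filter (fun j => (i, j) ∈ H ∧ (k, j) ∈ H)).card →
      6 ≤ ((Finset.range M).filter (fun j => (i2, j) ∈ H ∧ (k2, j) ∈ H)).card → False) :
    H.card ^ 2 ≤ 10 * M ^ 3 := by
  classical
  set cd : ℕ × ℕ → ℕ := fun x => ((Finset.range M).filter (fun j => (x.1, j) ∈ H ∧ (x.2, j) ∈ H)).card
    with hcd
  set R := Finset.range M
  have e1 : H.card = ∑ j ∈ R, (R.filter (fun i => (i, j) ∈ H)).card := by
    rw [Finset.card_eq_sum_card_fiberwise (f := Prod.snd) (t := R)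
      (fun x hx => by simpa [R] using (hH x hx).2)]
    apply Finset.sum_congr rfl
    intro j hj
    refine Finset.card_bij' (fun x _ => x.1) (fun i _ => (i, j)) ?_ ?_ ?_ ?_
    · rintro ⟨a, b⟩ hx
      simp at hx
      obtain ⟨h1, rfl⟩ := hx
      simpa [R, h1] using (hH _ h1).1
    · intro i hi
      simp at hi
      simp [hi]
    · rintro ⟨a, b⟩ hx
      simp at hx
      simp [hx]
    · intro i _
      rfl
  have e2 : ∑ j ∈ R, (R.filter (fun i => (i, j) ∈ H)).card ^ 2 = ∑ x ∈ R ×ˢ R, cd x := by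
    have : ∀ j, (R.filter (fun i => (i, j) ∈ H)).card ^ 2 =
        ∑ x ∈ R ×ˢ R, if (x.1, j) ∈ H ∧ (x.2, j) ∈ H then 1 else 0 := by
      intro j
      rw [← Finset.card_filter, sq, ← Finset.card_product, ← Finset.filter_product]
    simp_rw [this]
    rw [Finset.sum_comm]
    apply Finset.sum_congr rfl
    intro x _
    simp only [hcd]
    rw [Finset.card_filter]
  have e3 : H.card ^ 2 ≤ M * ∑ x ∈ R ×ˢ R, cd x := by
    rw [← e2, e1]
    have := sq_sum_le_card_mul_sum_sq (s := R) (f := fun j => (R.filter (fun i => (i, j) ∈ H)).card)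
    simpa [R] using this
  let E := (R ×ˢ R).filter (fun x => x.1 < x.2 ∧ 6 ≤ cd x)
  have hE : E.card ≤ 2 * M := by
    apply outer
    · intro x hx
      simp [E, R] at hx
      omega
    · intro x hx y hy a b c
      simp [E] at hx hy
      exact hnc x.1 y.1 x.2 y.2 a b c hx.2.2 hy.2.2
  have hM : ∀ x, cd x ≤ M := fun x => by
    refine (Finset.card_filter_le _ _).trans ?_
    simp [R]
  have sw : ∀ x, cd x.swap = cd x := fun x => by
    simp [hcd, and_comm]
  have pt : ∀ x ∈ R ×ˢ R, cd x ≤ 5 + M * ((if x.1 = x.2 then 1 else 0) + (if x ∈ E then 1 else 0)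
      + (if x.swap ∈ E then 1 else 0)) := by
    intro x hx
    have hx' : x.swap ∈ R ×ˢ R := by simp at hx ⊢; tauto
    by_cases h6 : 6 ≤ cd x
    · have : 1 ≤ ((if x.1 = x.2 then 1 else 0) + (if x ∈ E then 1 else 0)
      + (if x.swap ∈ E then 1 else 0)) := by
        rcases lt_trichotomy x.1 x.2 with h | h | h
        · have : x ∈ E := by simp only [E, Finset.mem_filter]; exact ⟨hx, h, h6⟩
          simp [this]; omega
        · simp [h]; omega
        · have : x.swap ∈ E := by
            simp only [E, Finset.mem_filter, sw]; exact ⟨hx', h, h6⟩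
          simp [this]
      have := Nat.mul_le_mul_left M this
      have := hM x
      omega
    · omega
  have e4 : ∑ x ∈ R ×ˢ R, cd x ≤ 10 * M ^ 2 := by
    refine (Finset.sum_le_sum pt).trans ?_
    rw [Finset.sum_add_distrib, ← Finset.mul_sum, Finset.sum_add_distrib, Finset.sum_add_distrib]
    have s1 : ∑ x ∈ R ×ˢ R, (if x.1 = x.2 then 1 else 0) = M := by
      rw [Finset.sum_product]
      have : ∀ i ∈ R, ∑ j ∈ R, (if i = j then 1 else 0) = 1 := by
        intro i hi
        simp [hi]
      rw [Finset.sum_congr rfl this]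
      simp [R]
    have s2 : ∑ x ∈ R ×ˢ R, (if x ∈ E then 1 else 0) ≤ 2 * M := by
      rw [← Finset.card_filter]
      refine le_trans (Finset.card_le_card ?_) hE
      intro x hx
      simp at hx; exact hx.2
    have s3 : ∑ x ∈ R ×ˢ R, (if x.swap ∈ E then 1 else 0) ≤ 2 * M := by
      rw [← Finset.card_filter]
      refine le_trans (Finset.card_le_card_of_injOn Prod.swap ?_ (Prod.swap_injective.injOn)) hE
      intro x hx
      simp at hx; exact hx.2
    rw [s1]
    have : ∑ x ∈ R ×ˢ R, 5 = 5 * M ^ 2 := by simp [R]; ring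
    rw [this]
    nlinarith
  calc H.card ^ 2 ≤ M * ∑ x ∈ R ×ˢ R, cd x := e3
    _ ≤ M * (10 * M ^ 2) := Nat.mul_le_mul_left _ e4
    _ = _ := by ring

lemma Config.count [Fintype ι] (h : Config G c c' L p q T s s') {m : ℕ} (hs : ∀ e, s (p e) ≤ m)
    (hs' : ∀ e, s' (q e) ≤ m) :
    Fintype.card ι ^ 2 ≤ 10 * (m + 1) ^ 3 ∧ Fintype.card ι ≤ (m + 1) ^ 2 := by
  classical
  let φ : ι → ℕ × ℕ := fun e => (s (p e), s' (q e))
  have φi : Function.Injective φ := by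
    intro e f hef
    simp only [φ, Prod.mk.injEq] at hef
    exact h.inj hef.1 hef.2
  let H := Finset.univ.image φ
  have hcard : H.card = Fintype.card ι := by
    rw [Finset.card_image_of_injective _ φi, Finset.card_univ]
  have hH : ∀ x ∈ H, x.1 < m + 1 ∧ x.2 < m + 1 := by
    intro x hx
    simp only [H, Finset.mem_image, Finset.mem_univ, true_and] at hx
    obtain ⟨e, rfl⟩ := hx
    have := hs e; have := hs' e
    simp only [φ]; omega
  rw [← hcard]
  constructor
  · apply LC.count hH
    intro i i2 k k2 h1 h2 h3 hA hB
    have hne : Nonempty ι := by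
      obtain ⟨j, hj⟩ := Finset.card_pos.1 (lt_of_lt_of_le (by norm_num) hA)
      simp only [H, Finset.mem_filter, Finset.mem_image] at hj
      obtain ⟨-, ⟨e, -⟩, -⟩ := hj
      exact ⟨e⟩
    have : ∀ i j, ∃ e : ι, (i, j) ∈ H → s (p e) = i ∧ s' (q e) = j := by
      intro i j
      by_cases hij : (i, j) ∈ H
      · have hij' := hij
        simp only [H, Finset.mem_image, Finset.mem_univ, true_and, φ, Prod.mk.injEq] at hij'
        obtain ⟨e, he⟩ := hij'
        exact ⟨e, fun _ => he⟩
      · exact ⟨hne.some, fun hh => absurd hh hij⟩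
    choose ε hε using this
    obtain ⟨j, j', g, g', hj, hj', hg, hg', jj, gg, jg, hP, hQ⟩ := pick hA hB
      (fun j => q (ε i j) < q (ε k j)) (fun j => q (ε i2 j) < q (ε k2 j))
    simp only [Finset.mem_filter] at hj hj' hg hg'
    have a := hε _ _ hj.2.1
    have a2 := hε _ _ hj.2.2
    have b := hε _ _ hj'.2.1
    have b2 := hε _ _ hj'.2.2
    have e := hε _ _ hg.2.1
    have e2 := hε _ _ hg.2.2
    have f := hε _ _ hg'.2.1
    have f2 := hε _ _ hg'.2.2
    exact h.no_cross (a := ε i j) (b := ε i j') (a2 := ε k j) (b2 := ε k j') (e := ε i2 g)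
      (f := ε i2 g') (e2 := ε k2 g) (f2 := ε k2 g') (by omega) (by omega) (by omega) (by omega)
      (by omega) (by omega) (by omega) (by omega) (by omega) (by omega) (by omega) (by omega)
      (by omega) (by omega) hP hQ
  · calc H.card ≤ (Finset.range (m + 1) ×ˢ Finset.range (m + 1)).card := by
          apply Finset.card_le_card
          intro x hx
          simpa using hH x hx
      _ = _ := by simp; ring

section link

variable [Fintype V] [DecidableEq V]

/-- the outer neighbourhood of a finite set -/
noncomputable def nb (G : SimpleGraph V) (S : Finset V) : Finset V :=
  open Classical in Finset.univ.filter (fun w => w ∉ S ∧ ∃ v ∈ S, G.Adj v w)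

lemma mem_nb {S : Finset V} {w : V} : w ∈ nb G S ↔ w ∉ S ∧ ∃ v ∈ S, G.Adj v w := by
  simp [nb]

lemma hall_step (A B : Finset V) (k : ℕ) (hk : k ≤ A.card)
    (hexp : ∀ S : Finset V, S.Nonempty → Disjoint S B → k ≤ (nb G S).card) :
    ∃ δ : ℕ, δ + k = A.card ∧ ∃ f : V → V ⊕ Fin δ, (∀ v w, v ∉ B → w ∉ B → f v = f w → v = w) ∧
      ∀ v w, v ∉ B → f v = Sum.inl w → w ∉ A ∧ (w = v ∨ G.Adj v w) := by
  classical
  let t : {v : V // v ∉ B} → Finset (V ⊕ Fin (A.card - k)) := fun v =>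
    Finset.disjSum (Finset.univ.filter (fun w => w ∉ A ∧ (w = v.1 ∨ G.Adj v.1 w))) Finset.univ
  have hall : ∀ s : Finset {v : V // v ∉ B}, s.card ≤ (s.biUnion t).card := by
    intro s
    rcases s.eq_empty_or_nonempty with rfl | hs
    · simp
    set S : Finset V := s.image Subtype.val with hS
    have hSc : S.card = s.card := Finset.card_image_of_injective _ Subtype.val_injective
    have h1 := hexp S (hs.image _) (by
      rw [Finset.disjoint_left]
      intro v hv
      simp [S] at hv
      exact hv.1)
    have hsub : Finset.disjSum ((S ∪ nb G S) \ A) (Finset.univ : Finset (Fin (A.card - k))) ⊆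
        s.biUnion t := by
      intro x hx
      rcases x with w | i
      · simp only [Finset.inl_mem_disjSum, Finset.mem_sdiff, Finset.mem_union, mem_nb] at hx
        obtain ⟨h | ⟨-, v, hv, hvw⟩, hA⟩ := hx
        · obtain ⟨v, hv, rfl⟩ := Finset.mem_image.1 h
          simp only [Finset.mem_biUnion, t]
          exact ⟨v, hv, by simp [hA]⟩
        · obtain ⟨v, hv', rfl⟩ := Finset.mem_image.1 hv
          simp only [Finset.mem_biUnion, t]
          exact ⟨v, hv', by simp [hA, hvw]⟩
      · obtain ⟨v, hv⟩ := hs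
        simp only [Finset.mem_biUnion, t]
        exact ⟨v, hv, by simp⟩
    have h2 := Finset.card_le_card hsub
    rw [Finset.card_disjSum] at h2
    have h3 : (S ∪ nb G S).card = S.card + (nb G S).card := by
      apply Finset.card_union_of_disjoint
      rw [Finset.disjoint_left]
      intro v hv hv'
      exact (mem_nb.1 hv').1 hv
    have h4 := Finset.le_card_sdiff A (S ∪ nb G S)
    simp at h2
    omega
  obtain ⟨f, hf, hft⟩ := (Finset.all_card_le_biUnion_card_iff_exists_injective t).1 hall
  refine ⟨A.card - k, by omega, fun v => if h : v ∉ B then f ⟨v, h⟩ else Sum.inl v, ?_, ?_⟩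
  · intro v w hv hw h
    simp only [hv, hw, not_false_eq_true, dif_pos] at h
    simpa using hf h
  · intro v w hv h
    simp only [hv, not_false_eq_true, dif_pos] at h
    have := hft ⟨v, hv⟩
    rw [h] at this
    simpa [t] using this

lemma linkage (A B : Finset V) (k : ℕ) (hk : k ≤ A.card)
    (hexp : ∀ S : Finset V, S.Nonempty → Disjoint S B → k ≤ (nb G S).card) :
    ∃ (P : Finset V) (en : V → V) (T : V → Set V), k ≤ P.card + (A ∩ B).card ∧
      (∀ a ∈ P, a ∈ A ∧ a ∉ B ∧ en a ∈ B ∧ en a ∉ A ∧ Disjoint (T a) A ∧ Disjoint (T a) B ∧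
        Conn G (T a) a (en a) 0) ∧
      (∀ a ∈ P, ∀ a' ∈ P, a ≠ a' → en a ≠ en a' ∧ Disjoint (T a) (T a')) := by
  classical
  obtain ⟨δ, hδ, f, finj, fadj⟩ := hall_step (G := G) A B k hk hexp
  let g : V ⊕ Fin δ → V ⊕ Fin δ := Sum.elim f Sum.inr
  let tm : V ⊕ Fin δ → Prop := Sum.elim (fun v => v ∈ B) (fun _ => True)
  have ginj : ∀ x y, ¬ tm x → ¬ tm y → g x = g y → x = y := by
    rintro (x | x) (y | y) hx hy h <;> simp [tm, g] at *
    exact finj x y hx hy h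
  have gA : ∀ x a, a ∈ A → ¬ tm x → g x ≠ Sum.inl a := by
    rintro (x | x) a ha hx h <;> simp [tm, g] at *
    exact (fadj x a hx h).1 ha
  have key : ∀ i j a a', a ∈ A → a' ∈ A → (∀ t < i, ¬ tm (g^[t] (Sum.inl a))) →
      (∀ t < j, ¬ tm (g^[t] (Sum.inl a'))) → g^[i] (Sum.inl a) = g^[j] (Sum.inl a') →
      a = a' ∧ i = j := by
    intro i
    induction i with
    | zero =>
      intro j a a' ha ha' hi hj h
      rcases j with _ | j
      · simpa using h
      · rw [Function.iterate_succ_apply'] at h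
        exact absurd h.symm (gA _ _ ha (hj j (by omega)))
    | succ i ih =>
      intro j a a' ha ha' hi hj h
      rcases j with _ | j
      · rw [Function.iterate_succ_apply'] at h
        exact absurd h (gA _ _ ha' (hi i (by omega)))
      · rw [Function.iterate_succ_apply', Function.iterate_succ_apply'] at h
        have := ginj _ _ (hi i (by omega)) (hj j (by omega)) h
        have := ih j a a' ha ha' (fun t ht => hi t (by omega)) (fun t ht => hj t (by omega)) this
        exact ⟨this.1, by omega⟩
  have ex : ∀ a ∈ A, ∃ r, tm (g^[r] (Sum.inl a)) := by
    intro a ha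
    by_contra! hh
    obtain ⟨i, j, hij, he⟩ := Finite.exists_ne_map_eq_of_infinite
      (fun r : ℕ => g^[r] (Sum.inl a : V ⊕ Fin δ))
    exact hij (key i j a a ha ha (fun t _ => hh t) (fun t _ => hh t) he).2
  let r : V → ℕ := fun a => if h : ∃ r, tm (g^[r] (Sum.inl a)) then Nat.find h else 0
  have r1 : ∀ a ∈ A, tm (g^[r a] (Sum.inl a)) := by
    intro a ha
    simp only [r, dif_pos (ex a ha)]
    exact Nat.find_spec (ex a ha)
  have r2 : ∀ a ∈ A, ∀ t < r a, ¬ tm (g^[t] (Sum.inl a)) := by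
    intro a ha t ht
    simp only [r, dif_pos (ex a ha)] at ht
    exact Nat.find_min (ex a ha) ht
  let w : V → ℕ → V := fun a t => Sum.elim id (fun _ => a) (g^[t] (Sum.inl a))
  let good : V → Prop := fun a => ∃ b, g^[r a] (Sum.inl a) = Sum.inl b
  have hw : ∀ a ∈ A, good a → ∀ t ≤ r a, g^[t] (Sum.inl a) = Sum.inl (w a t) := by
    intro a ha ⟨b, hb⟩ t ht
    rcases ht.lt_or_eq with ht | rfl
    · have := r2 a ha t ht
      rcases hx : g^[t] (Sum.inl a) with v | i
      · simp [w, hx]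
      · rw [hx] at this
        simp [tm] at this
    · simp [w, hb]
  -- counting
  have hbad : (A.filter (fun a => ¬ good a)).card ≤ δ := by
    have : ∀ a ∈ A.filter (fun a => ¬ good a), ∃ i, g^[r a] (Sum.inl a) = Sum.inr i := by
      intro a ha
      have := (Finset.mem_filter.1 ha).2
      rcases hx : g^[r a] (Sum.inl a) with v | i
      · exact absurd ⟨v, hx⟩ this
      · exact ⟨i, rfl⟩
    have h0 : (A.filter (fun a => ¬ good a)).card ≤
        ((Finset.univ : Finset (Fin δ)).image Sum.inr : Finset (V ⊕ Fin δ)).card := by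
      apply Finset.card_le_card_of_injOn (fun a => g^[r a] (Sum.inl a))
      · intro a ha
        obtain ⟨i, hi⟩ := this a ha
        simp [hi]
      · intro a ha a' ha' h
        have ha := (Finset.mem_filter.1 ha).1
        have ha' := (Finset.mem_filter.1 ha').1
        exact (key _ _ a a' ha ha' (r2 a ha) (r2 a' ha') h).1
    refine h0.trans (Finset.card_image_le.trans ?_)
    simp
  have hgood : k ≤ (A.filter good).card := by
    have := Finset.card_filter_add_card_filter_not (s := A) good
    omega
  have hr : ∀ a ∈ A, a ∉ B → 0 < r a := by
    intro a ha hb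
    by_contra h0
    have h0 : r a = 0 := by omega
    have := r1 a ha
    rw [h0] at this
    exact hb this
  refine ⟨(A.filter good) \ B, fun a => w a (r a), fun a => {x | ∃ t, 0 < t ∧ t < r a ∧ w a t = x},
    ?_, ?_, ?_⟩
  · have h1 : (A.filter good ∩ B).card ≤ (A ∩ B).card :=
      Finset.card_le_card (Finset.inter_subset_inter_right (Finset.filter_subset _ _))
    have h2 := Finset.card_sdiff_add_card_inter (A.filter good) B
    omega
  · intro a ha
    simp only [Finset.mem_sdiff, Finset.mem_filter] at ha
    obtain ⟨⟨ha, hg⟩, hb⟩ := ha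
    have hr0 := hr a ha hb
    have hwa := hw a ha hg
    have hnA : ∀ t, 0 < t → t ≤ r a → w a t ∉ A := by
      intro t h0 ht hA
      have := hwa t ht
      obtain ⟨t, rfl⟩ := Nat.exists_eq_succ_of_ne_zero h0.ne'
      rw [Function.iterate_succ_apply'] at this
      exact gA _ _ hA (r2 a ha t (by omega)) this
    have hnB : ∀ t, t < r a → w a t ∉ B := by
      intro t ht hB
      have := r2 a ha t ht
      rw [hwa t ht.le] at this
      exact this hB
    have hinj : ∀ i ≤ r a, ∀ j ≤ r a, w a i = w a j → i = j := by
      intro i hi j hj h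
      refine (key i j a a ha ha (fun t ht => r2 a ha t (by omega)) (fun t ht => r2 a ha t (by omega)) ?_).2
      rw [hwa i hi, hwa j hj, h]
    have hadj : ∀ t < r a, G.Adj (w a t) (w a (t + 1)) := by
      intro t ht
      have h1 := hwa (t + 1) ht
      rw [Function.iterate_succ_apply', hwa t ht.le] at h1
      rcases (fadj _ _ (hnB t ht) h1).2 with h | h
      · have := hinj _ ht _ ht.le h
        omega
      · exact h
    refine ⟨ha, hb, ?_, hnA _ hr0 le_rfl, ?_, ?_, ?_⟩
    · have := r1 a ha
      rw [hwa _ le_rfl] at this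
      exact this
    · rw [Set.disjoint_left]
      rintro x ⟨t, h0, ht, rfl⟩
      exact hnA t h0 ht.le
    · rw [Set.disjoint_left]
      rintro x ⟨t, h0, ht, rfl⟩
      exact hnB t ht
    · refine ⟨(List.range (r a - 1)).map (fun t => w a (t + 1)), by simp, ?_, ?_, ?_⟩
      · have e : a :: ((List.range (r a - 1)).map (fun t => w a (t + 1)) ++ [w a (r a)]) =
            (List.range (r a + 1)).map (w a) := by
          obtain ⟨n, hn⟩ := Nat.exists_eq_succ_of_ne_zero hr0.ne'
          rw [hn, List.range_succ_eq_map, List.range_succ]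
          simp [w, Function.comp_def]
        rw [e, List.isChain_iff_getElem]
        intro i hi
        simp at hi ⊢
        exact hadj i (by omega)
      · apply List.Nodup.map_on _ List.nodup_range
        intro x hx y hy hxy
        simp at hx hy
        have := hinj (x + 1) (by omega) (y + 1) (by omega) hxy
        omega
      · intro v hv
        simp at hv
        obtain ⟨t, ht, rfl⟩ := hv
        exact ⟨t + 1, by omega, by omega, rfl⟩
  · intro a ha a' ha' hne
    simp only [Finset.mem_sdiff, Finset.mem_filter] at ha ha'
    obtain ⟨⟨ha, hg⟩, hb⟩ := ha
    obtain ⟨⟨ha', hg'⟩, hb'⟩ := ha'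
    have kk : ∀ i ≤ r a, ∀ j ≤ r a', w a i ≠ w a' j := by
      intro i hi j hj h
      refine hne (key i j a a' ha ha' (fun t ht => r2 a ha t (by omega))
        (fun t ht => r2 a' ha' t (by omega)) ?_).1
      rw [hw a ha hg i hi, hw a' ha' hg' j hj, h]
    refine ⟨kk _ le_rfl _ le_rfl, ?_⟩
    rw [Set.disjoint_left]
    rintro x ⟨t, h0, ht, rfl⟩ ⟨t', h0', ht', h⟩
    exact kk t ht.le t' ht'.le h.symm

end link

section conn

variable [Fintype V] [DecidableEq V]

lemma nb_submod (X Y : Finset V) :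
    (nb G (X ∩ Y)).card + (nb G (X ∪ Y)).card ≤ (nb G X).card + (nb G Y).card := by
  rw [← Finset.card_union_add_card_inter (nb G (X ∩ Y)),
    ← Finset.card_union_add_card_inter (nb G X)]
  apply Nat.add_le_add <;> apply Finset.card_le_card
  · intro w hw
    simp only [Finset.mem_union, Finset.mem_inter, mem_nb] at hw ⊢
    rcases hw with ⟨h, v, hv, hvw⟩ | ⟨h, v, hv, hvw⟩
    · by_cases hX : w ∈ X
      · exact Or.inr ⟨fun hY => h ⟨hX, hY⟩, v, hv.2, hvw⟩
      · exact Or.inl ⟨hX, v, hv.1, hvw⟩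
    · push Not at h
      rcases hv with hv | hv
      · exact Or.inl ⟨h.1, v, hv, hvw⟩
      · exact Or.inr ⟨h.2, v, hv, hvw⟩
  · intro w hw
    simp only [Finset.mem_union, Finset.mem_inter, mem_nb] at hw ⊢
    obtain ⟨⟨-, v, hv, hvw⟩, h, -⟩ := hw
    push Not at h
    exact ⟨⟨h.1, v, hv.1, hvw⟩, ⟨h.2, v, hv.2, hvw⟩⟩

lemma nb_image (g : G ≃g G) (S : Finset V) : nb G (S.image g) = (nb G S).image g := by
  ext w
  simp only [mem_nb, Finset.mem_image]
  constructor
  · rintro ⟨h, v, ⟨u, hu, rfl⟩, hvw⟩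
    refine ⟨g.symm w, ⟨fun hh => h ⟨_, hh, by simp⟩, u, hu, ?_⟩, by simp⟩
    rw [← g.map_adj_iff]
    simpa using hvw
  · rintro ⟨x, ⟨hx, v, hv, hvx⟩, rfl⟩
    refine ⟨?_, g v, ⟨v, hv, rfl⟩, g.map_adj_iff.2 hvx⟩
    rintro ⟨y, hy, hyx⟩
    exact hx (g.injective hyx ▸ hy)

lemma cl_mono {X Y : Finset V} (h : X ⊆ Y) : X ∪ nb G X ⊆ Y ∪ nb G Y := by
  intro w hw
  simp only [Finset.mem_union, mem_nb] at hw ⊢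
  by_cases hY : w ∈ Y
  · exact Or.inl hY
  · rcases hw with hw | ⟨-, v, hv, hvw⟩
    · exact absurd (h hw) hY
    · exact Or.inr ⟨hY, v, h hv, hvw⟩

lemma cl_disj (X : Finset V) : Disjoint X (nb G X) := by
  rw [Finset.disjoint_left]
  intro v hv hv'
  exact (mem_nb.1 hv').1 hv

lemma expand [DecidableRel G.Adj] {d : ℕ} (hconn : G.Connected) (hreg : G.IsRegularOfDegree d)
    (hvt : IsVertexTransitive G) (S : Finset V) (hS : S.Nonempty)
    (hS' : S ∪ nb G S ≠ Finset.univ) : d + 1 ≤ 2 * (nb G S).card := by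
  classical
  let Frag : Finset V → Prop := fun S => S.Nonempty ∧ S ∪ nb G S ≠ Finset.univ
  obtain ⟨S0, hS0, hmin0⟩ := Finset.exists_min_image (Finset.univ.filter Frag)
    (fun S => (nb G S).card) ⟨S, by simp only [Finset.mem_filter, Frag]; exact ⟨Finset.mem_univ _, hS, hS'⟩⟩
  obtain ⟨A, hA, hminA⟩ := Finset.exists_min_image
    ((Finset.univ.filter Frag).filter (fun S => (nb G S).card ≤ (nb G S0).card))
    (fun S => S.card) ⟨S0, by simp only [Finset.mem_filter] at hS0 ⊢; exact ⟨hS0, le_rfl⟩⟩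
  simp only [Finset.mem_filter, Finset.mem_univ, true_and] at hS0 hmin0 hA hminA
  obtain ⟨⟨hAne, hAcl⟩, hA0⟩ := hA
  have hκ : ∀ S, Frag S → (nb G A).card ≤ (nb G S).card := fun S hS => hA0.trans (hmin0 S hS)
  have hat : ∀ S, Frag S → (nb G S).card ≤ (nb G A).card → A.card ≤ S.card := fun S hS h =>
    hminA S ⟨hS, h.trans hA0⟩
  have main : A.card ≤ (nb G A).card := by
    by_contra hlt
    push Not at hlt
    -- a boundary vertex
    obtain ⟨u0, hu0⟩ := hAne
    obtain ⟨x0, hx0⟩ : ∃ x, x ∉ A := by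
      by_contra! hh
      exact hAcl (Finset.eq_univ_of_forall fun x => Finset.mem_union_left _ (hh x))
    obtain ⟨v, hv⟩ : (nb G A).Nonempty := by
      obtain ⟨W⟩ := hconn.preconnected u0 x0
      obtain ⟨dd, -, h1, h2⟩ := W.exists_boundary_dart (A : Set V) (by simpa using hu0) (by simpa using hx0)
      exact ⟨dd.snd, mem_nb.2 ⟨by simpa using h2, dd.fst, by simpa using h1, dd.adj⟩⟩
    obtain ⟨g, hg⟩ := hvt u0 v
    set B := A.image g with hB
    have hvA : v ∉ A := (mem_nb.1 hv).1
    have hvB : v ∈ B := Finset.mem_image.2 ⟨u0, hu0, hg⟩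
    have hBc : B.card = A.card := Finset.card_image_of_injective _ g.injective
    have hBn : (nb G B).card = (nb G A).card := by
      rw [hB, nb_image, Finset.card_image_of_injective _ g.injective]
    have cardcl : ∀ X : Finset V, (X ∪ nb G X).card = X.card + (nb G X).card := fun X =>
      Finset.card_union_of_disjoint (cl_disj X)
    set R := Finset.univ \ (A ∪ nb G A) with hR
    have hRmem : ∀ x, x ∈ R ↔ x ∉ A ∧ x ∉ nb G A := by
      intro x; simp [R]
    have hRA : ∀ r ∈ R, ∀ a ∈ A, ¬ G.Adj r a := by
      intro r hr a ha h
      have := (hRmem r).1 hr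
      exact this.2 (mem_nb.2 ⟨this.1, a, ha, h.symm⟩)
    have hRne : R.Nonempty := by
      by_contra hh
      rw [Finset.not_nonempty_iff_eq_empty] at hh
      apply hAcl
      apply Finset.eq_univ_of_forall
      intro x
      by_contra hx
      have : x ∈ R := by simp only [hR, Finset.mem_sdiff, Finset.mem_univ, true_and]; exact hx
      rw [hh] at this
      simp at this
    have hRn : nb G R ⊆ nb G A := by
      intro w hw
      obtain ⟨h1, r, hr, hrw⟩ := mem_nb.1 hw
      by_contra h2
      have hwA : w ∉ A := fun h => hRA r hr w h hrw
      exact h1 ((hRmem w).2 ⟨hwA, h2⟩)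
    have hRnc := Finset.card_le_card hRn
    have hRF : Frag R := by
      refine ⟨hRne, fun h => ?_⟩
      have := h ▸ Finset.mem_univ u0
      rcases Finset.mem_union.1 this with h | h
      · exact ((hRmem _).1 h).1 hu0
      · exact (mem_nb.1 (hRn h)).1 hu0
    have hRc : A.card ≤ R.card := hat R hRF hRnc
    have hn : Fintype.card V = A.card + (nb G A).card + R.card := by
      rw [← cardcl, hR, ← Finset.card_univ, add_comm,
        Finset.card_sdiff_add_card_eq_card (Finset.subset_univ _)]
    have step1 : Disjoint A B := by
      by_contra hd
      have hne : (A ∩ B).Nonempty := by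
        rw [Finset.not_disjoint_iff_nonempty_inter] at hd; exact hd
      have hF : Frag (A ∩ B) := by
        refine ⟨hne, fun h => hAcl ?_⟩
        apply Finset.eq_univ_of_forall
        intro x
        exact cl_mono (Finset.inter_subset_left) (h ▸ Finset.mem_univ x)
      have h1 : (nb G A).card < (nb G (A ∩ B)).card := by
        by_contra hh
        have h2 := hat _ hF (not_lt.1 hh)
        have h3 : A ∩ B = B := Finset.eq_of_subset_of_card_le Finset.inter_subset_right (by omega)
        exact hvA (Finset.mem_inter.1 (h3 ▸ hvB)).1
      have h2 := nb_submod (G := G) A B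
      have h3 : (A ∪ B) ∪ nb G (A ∪ B) = Finset.univ := by
        by_contra hh
        have := hκ _ ⟨⟨u0, Finset.mem_union_left _ hu0⟩, hh⟩
        omega
      have h4 := cardcl (A ∪ B)
      rw [h3, Finset.card_univ] at h4
      have h5 := Finset.card_union_le A B
      omega
    have hBcl : B ∪ nb G B ≠ Finset.univ := by
      intro h
      have h1 := cardcl B
      rw [h, Finset.card_univ] at h1
      have := hRne.card_pos
      omega
    by_cases hBR : (B ∩ R).Nonempty
    · obtain ⟨a, ha, haB⟩ : ∃ a ∈ A, a ∉ nb G B := by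
        by_contra! hh
        have := Finset.card_le_card (show A ⊆ nb G B from hh)
        omega
      have F1 : Frag (B ∪ R) := by
        refine ⟨⟨v, Finset.mem_union_left _ hvB⟩, fun h => ?_⟩
        have haB' : a ∉ B := Finset.disjoint_left.1 step1 ha
        have := h ▸ Finset.mem_univ a
        simp only [Finset.mem_union, mem_nb] at this
        rcases this with (h | h) | ⟨-, y, hy | hy, hya⟩
        · exact haB' h
        · exact ((hRmem _).1 h).1 ha
        · exact haB (mem_nb.2 ⟨haB', y, hy, hya⟩)
        · exact hRA y hy a ha hya
      have F2 : Frag (B ∩ R) := by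
        refine ⟨hBR, fun h => hBcl ?_⟩
        apply Finset.eq_univ_of_forall
        intro x
        exact cl_mono (Finset.inter_subset_left) (h ▸ Finset.mem_univ x)
      have h1 := hκ _ F1
      have h2 := nb_submod (G := G) B R
      have h3 := hat _ F2 (by omega)
      have h4 : B ∩ R = B := Finset.eq_of_subset_of_card_le Finset.inter_subset_left (by omega)
      have h5 := (Finset.mem_inter.1 (h4.symm ▸ hvB)).2
      exact ((hRmem v).1 h5).2 hv
    · have : B ⊆ nb G A := by
        intro b hb
        by_contra h
        exact hBR ⟨b, Finset.mem_inter.2 ⟨hb, (hRmem b).2 ⟨Finset.disjoint_right.1 step1 hb, h⟩⟩⟩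
      have := Finset.card_le_card this
      omega
  obtain ⟨a, ha⟩ := hAne
  have h1 : insert a (G.neighborFinset a) ⊆ A ∪ nb G A := by
    intro x hx
    simp only [Finset.mem_insert, SimpleGraph.mem_neighborFinset] at hx
    simp only [Finset.mem_union, mem_nb]
    by_cases hxA : x ∈ A
    · exact Or.inl hxA
    · rcases hx with rfl | hx
      · exact absurd ha hxA
      · exact Or.inr ⟨hxA, a, ha, hx⟩
  have h2 := Finset.card_le_card h1
  rw [Finset.card_insert_of_notMem (by simp), G.card_neighborFinset_eq_degree, hreg a] at h2
  have h3 := Finset.card_union_le A (nb G A)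
  have h4 := hκ S ⟨hS, hS'⟩
  omega

end conn

section cyc

variable [Fintype V] [DecidableEq V]

lemma exists_long [DecidableRel G.Adj] [Nonempty V] {d : ℕ} (hd : 2 ≤ d)
    (hreg : G.IsRegularOfDegree d) :
    ∃ (S : Set V) (u v : V), PE G S u v (d + 1) ∧ G.Adj v u := by
  classical
  let Q : ℕ → Prop := fun k => ∃ l : List V, l.IsChain G.Adj ∧ l.Nodup ∧ l.length = k
  have hb : ∀ k, Q k → k ≤ Fintype.card V := by
    rintro k ⟨l, -, h, rfl⟩
    exact h.length_le_card
  obtain ⟨v0⟩ := ‹Nonempty V›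
  have h1 : Q 1 := ⟨[v0], by simp, by simp, rfl⟩
  have hQ := Nat.findGreatest_spec (hb 1 h1) h1
  have hQ1 := Nat.le_findGreatest (hb 1 h1) h1
  set K := Nat.findGreatest Q (Fintype.card V) with hK
  have hmax : ∀ k, Q k → k ≤ K := fun k hk => Nat.le_findGreatest (hb k hk) hk
  obtain ⟨l, hch, hnd, hlen⟩ := hQ
  rcases l with _ | ⟨u, t⟩
  · simp at hlen; omega
  have hnb : ∀ w, G.Adj u w → w ∈ u :: t := by
    intro w hw
    by_contra hcon
    have := hmax (K + 1) ⟨w :: u :: t, ?_, ?_, by simp at hlen ⊢; omega⟩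
    · omega
    · simp only [List.isChain_cons_cons]
      exact ⟨hw.symm, hch⟩
    · exact List.nodup_cons.2 ⟨hcon, hnd⟩
  have hcard : (G.neighborFinset u).card = d := hreg u
  obtain ⟨w, hw, hwmax⟩ := Finset.exists_max_image (G.neighborFinset u)
    (fun w => (u :: t).idxOf w) (Finset.card_pos.1 (by omega))
  rw [SimpleGraph.mem_neighborFinset] at hw
  set i := (u :: t).idxOf w with hi
  have hil : i < (u :: t).length := List.idxOf_lt_length_of_mem (hnb w hw)
  have hgi : (u :: t)[i] = w := List.getElem_idxOf hil
  have hlast : ((u :: t).take (i + 1)).getLast? = some w := by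
    rw [List.getLast?_eq_getElem?, List.length_take, min_eq_left (by omega)]
    simp only [Nat.add_sub_cancel]
    rw [List.getElem?_take_of_lt (by omega), List.getElem?_eq_getElem hil, hgi]
  have hsub : insert u (G.neighborFinset u) ⊆ ((u :: t).take (i + 1)).toFinset := by
    intro x hx
    rw [Finset.mem_insert] at hx
    rw [List.mem_toFinset]
    rcases hx with rfl | hx
    · simp
    · have h2 := hwmax x hx
      rw [SimpleGraph.mem_neighborFinset] at hx
      have h3 := List.idxOf_lt_length_of_mem (hnb x hx)
      have h4 : (u :: t)[(u :: t).idxOf x] = x := List.getElem_idxOf h3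
      rw [List.mem_take_iff_getElem]
      refine ⟨(u :: t).idxOf x, ?_, h4⟩
      omega
  have hc := (Finset.card_le_card hsub).trans (List.toFinset_card_le _)
  rw [Finset.card_insert_of_notMem (by simp), hcard] at hc
  exact ⟨Set.univ, u, w, ⟨_, hc, hch.take _, hnd.sublist (List.take_sublist _ _), by simp,
    by simp, hlast⟩, hw.symm⟩

lemma exists_maxcyc [DecidableRel G.Adj] [Nonempty V] {d : ℕ} (hd : 2 ≤ d)
    (hreg : G.IsRegularOfDegree d) :
    ∃ (c : ℕ → V) (L : ℕ), Cyc_s2 G c L ∧ IsMaxL G L ∧ d + 1 ≤ L ∧ 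
      ∃ (x : V) (W : G.Walk x x), W.IsCycle ∧ W.length = L := by
  classical
  let Q : ℕ → Prop := fun k => ∃ (S : Set V) (u v : V), PE G S u v k ∧ G.Adj v u
  have hb : ∀ k, Q k → k ≤ Fintype.card V := by
    rintro k ⟨S, u, v, ⟨l, hl, -, h, -⟩, -⟩
    exact hl.trans h.length_le_card
  have h1 : Q (d + 1) := exists_long hd hreg
  have hQ := Nat.findGreatest_spec (hb _ h1) h1
  have hQ1 := Nat.le_findGreatest (hb _ h1) h1
  set L := Nat.findGreatest Q (Fintype.card V) with hK
  have hmax : ∀ k, Q k → k ≤ L := fun k hk => Nat.le_findGreatest (hb k hk) hk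
  obtain ⟨S, u, v, ⟨l, hlen, hch, hnd, hS, hh, hlast⟩, hadj⟩ := hQ
  have hlen' : l.length = L := le_antisymm
    (hmax _ ⟨S, u, v, ⟨l, le_rfl, hch, hnd, hS, hh, hlast⟩, hadj⟩) hlen
  have hgd : ∀ i (hi : i < l.length), l.getD i u = l[i] := fun i hi =>
    List.getD_eq_getElem _ _ hi
  refine ⟨fun i => l.getD i u, L, ⟨?_, ?_, ?_, by omega⟩, ?_, hQ1, ?_⟩
  · intro i hi j hj hij
    simp only [Set.mem_Iio] at hi hj
    simp only at hij
    rw [hgd i (by omega), hgd j (by omega)] at hij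
    exact (List.Nodup.getElem_inj_iff hnd).1 hij
  · intro p hp
    rw [hgd p (by omega), hgd (p+1) (by omega)]
    exact List.isChain_iff_getElem.1 hch p (by omega)
  · rw [List.getLast?_eq_getElem?, List.getElem?_eq_getElem (by omega)] at hlast
    rw [List.head?_eq_getElem?, List.getElem?_eq_getElem (by omega)] at hh
    rw [hgd _ (by omega), hgd _ (by omega), Option.some_inj.1 hh]
    have := Option.some_inj.1 hlast
    simp only [hlen'] at this
    rw [this]
    exact hadj
  · intro S u v k h1 h2
    exact hmax k ⟨S, u, v, h1, h2⟩
  · have hne : l ≠ [] := by rintro rfl; simp at hh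
    have hh' : l.head hne = u := by rw [List.head?_eq_some_head hne] at hh; simpa using hh
    have hl' : l.getLast hne = v := by rw [List.getLast?_eq_some_getLast hne] at hlast; simpa using hlast
    let P : G.Walk u v := (Walk.ofSupport l hne hch).copy hh' hl'
    have hPs : P.support = l := by simp [P]
    have hPl : P.length + 1 = L := by rw [← Walk.length_support, hPs, hlen']
    have hPp : P.IsPath := Walk.IsPath.mk' (by rw [hPs]; exact hnd)
    refine ⟨v, Walk.cons hadj P, ?_, by simpa using hPl⟩
    rw [Walk.isCycle_iff_isPath_tail_and_le_length]
    refine ⟨by simpa using hPp, ?_⟩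
    rw [Walk.length_cons]
    omega

lemma exists_g (hvt : IsVertexTransitive G) (C : Finset V) :
    ∃ g : G ≃g G, (C ∩ C.image g).card * Fintype.card V ≤ C.card ^ 2 := by
  classical
  have hfin : Finite (G ≃g G) := Finite.of_injective (fun g : G ≃g G => (g : V → V)) DFunLike.coe_injective
  have := Fintype.ofFinite (G ≃g G)
  by_contra! hcon
  -- all fibres have the same size
  have hN : ∀ u v u' v' : V, (Finset.univ.filter (fun g : G ≃g G => g u = v)).card ≤
      (Finset.univ.filter (fun g : G ≃g G => g u' = v')).card := by
    intro u v u' v'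
    obtain ⟨a, ha⟩ := hvt u' u
    obtain ⟨b, hb⟩ := hvt v v'
    apply Finset.card_le_card_of_injOn (fun g => (a.trans g).trans b)
    · intro g hg
      simp at hg ⊢
      simp [ha, hg, hb]
    · intro g _ g' _ h
      ext x
      have := DFunLike.congr_fun h (a.symm x)
      simpa using this
  rcases C.eq_empty_or_nonempty with rfl | ⟨u0, hu0⟩
  · have := hcon (RelIso.refl _)
    simp at this
  set N := (Finset.univ.filter (fun g : G ≃g G => g u0 = u0)).card with hNd
  have hN' : ∀ u v, (Finset.univ.filter (fun g : G ≃g G => g u = v)).card = N :=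
    fun u v => le_antisymm (hN _ _ _ _) (hN _ _ _ _)
  have hA : Fintype.card (G ≃g G) = Fintype.card V * N := by
    have := Finset.card_eq_sum_card_fiberwise (s := (Finset.univ : Finset (G ≃g G)))
      (t := (Finset.univ : Finset V)) (f := fun g => g u0) (by simp)
    simp only [hN'] at this
    simpa using this
  have hS : ∑ g : G ≃g G, (C ∩ C.image g).card = C.card ^ 2 * N := by
    have h1 : ∀ g : G ≃g G, (C ∩ C.image g).card = ∑ u ∈ C, ∑ v ∈ C, if g u = v then 1 else 0 := by
      intro g
      rw [Finset.inter_comm, ← Finset.filter_mem_eq_inter, Finset.filter_image,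
        Finset.card_image_of_injective _ g.injective, Finset.card_filter]
      refine Finset.sum_congr rfl fun u _ => ?_
      simp
    simp only [h1]
    rw [Finset.sum_comm]
    simp_rw [Finset.sum_comm (s := Finset.univ), ← Finset.card_filter, hN']
    simp
    ring
  have hlt : ∑ g : G ≃g G, C.card ^ 2 < ∑ g : G ≃g G, (C ∩ C.image g).card * Fintype.card V :=
    Finset.sum_lt_sum_of_nonempty ⟨RelIso.refl _, by simp⟩ (fun g _ => hcon g)
  rw [← Finset.sum_mul, hS] at hlt
  simp [hA] at hlt
  nlinarith

end cyc
section fin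

lemma Cyc_s2.map {c : ℕ → V} {L : ℕ} (h : Cyc_s2 G c L) (g : G ≃g G) : Cyc_s2 G (fun i => g (c i)) L :=
  ⟨fun i hi j hj hij => h.inj hi hj (g.injective hij), fun p hp => g.map_adj_iff.2 (h.adj p hp),
    g.map_adj_iff.2 h.close, h.pos⟩

/-- number of positions up to `a` whose vertex lies in `X` -/
noncomputable def sg (c : ℕ → V) (X : Set V) (a : ℕ) : ℕ :=
  open Classical in ((Finset.range (a + 1)).filter (fun r => c r ∈ X)).card

lemma sg_mono (c : ℕ → V) (X : Set V) : Monotone (sg c X) := by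
  classical
  intro a b hab
  apply Finset.card_le_card
  intro r
  simp only [Finset.mem_filter, Finset.mem_range]
  rintro ⟨h1, h2⟩
  exact ⟨by omega, h2⟩

lemma sg_sep {c : ℕ → V} {X : Set V} {a b r : ℕ} (hab : sg c X a = sg c X b) (ha : c a ∉ X)
    (har : a ≤ r) (hrb : r ≤ b) : c r ∉ X := by
  classical
  intro hr
  have hne : r ≠ a := by rintro rfl; exact ha hr
  have : sg c X a < sg c X b := by
    apply Finset.card_lt_card
    rw [Finset.ssubset_iff_of_subset]
    · exact ⟨r, by simp; exact ⟨by omega, hr⟩, by simp; intro; omega⟩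
    · intro x
      simp only [Finset.mem_filter, Finset.mem_range]
      rintro ⟨h1, h2⟩
      exact ⟨by omega, h2⟩
  omega

lemma sg_le {c : ℕ → V} {L : ℕ} (h : Cyc_s2 G c L) (X : Finset V) (Y : Finset V) (a : ℕ) (ha : a < L)
    (hY : ∀ r < L, c r ∈ X → c r ∈ Y) : sg c (X : Set V) a ≤ Y.card := by
  classical
  apply Finset.card_le_card_of_injOn c
  · intro r hr
    simp at hr
    exact hY r (by omega) hr.2
  · intro r hr r' hr' hh
    simp at hr hr'
    exact h.inj (by simp; omega) (by simp; omega) hh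

variable [Fintype V] [DecidableEq V]

lemma main_comb [DecidableRel G.Adj] {d : ℕ} (hd : 2 ≤ d) (hconn : G.Connected)
    (hreg : G.IsRegularOfDegree d) (hvt : IsVertexTransitive G) :
    ∃ (x : V) (W : G.Walk x x) (m k : ℕ), W.IsCycle ∧ m * Fintype.card V ≤ W.length ^ 2 ∧
      d + 1 ≤ 2 * k ∧ ∃ N : ℕ, k ≤ N + m ∧ N ^ 2 ≤ 10 * (m + 1) ^ 3 ∧ N ≤ (m + 1) ^ 2 := by
  classical
  have := hconn.nonempty
  obtain ⟨c, L, hc, hmax, hdL, x, W, hW, hWL⟩ := exists_maxcyc hd hreg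
  set A : Finset V := (Finset.range L).image c with hA
  have hAc : A.card = L := by
    rw [hA, Finset.card_image_of_injOn, Finset.card_range]
    intro i hi j hj hij
    exact hc.inj (by simpa using hi) (by simpa using hj) hij
  obtain ⟨g, hg⟩ := exists_g hvt A
  set c' : ℕ → V := fun i => g (c i) with hc'd
  have hc' : Cyc_s2 G c' L := hc.map g
  set B : Finset V := A.image g with hB
  have hBc : B.card = L := by rw [hB, Finset.card_image_of_injective _ g.injective, hAc]
  have hAm : ∀ v, v ∈ A ↔ ∃ i < L, c i = v := by intro v; simp [hA]
  have hBm : ∀ v, v ∈ B ↔ ∃ i < L, c' i = v := by intro v; simp [hA, hB, c']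
  have hAs : c '' Set.Iio L = (A : Set V) := by ext v; simp [hA]
  have hBs : c' '' Set.Iio L = (B : Set V) := by ext v; simp [hA, hB, c']
  set k := (d + 2) / 2 with hk
  obtain ⟨P, en, T, hPk, hP1, hP2⟩ := linkage (G := G) A B k (by omega) (by
    intro S hS hSB
    by_cases hu : S ∪ nb G S = Finset.univ
    · have : B ⊆ nb G S := by
        intro v hv
        have h1 : v ∈ S ∪ nb G S := by rw [hu]; simp
        rcases Finset.mem_union.1 h1 with h1 | h1
        · exact absurd hv (Finset.disjoint_left.1 hSB h1)
        · exact h1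
      have := Finset.card_le_card this
      omega
    · have := expand hconn hreg hvt S hS hu
      omega)
  choose p hp hpc using fun e : {a // a ∈ P} => (hAm e.1).1 (hP1 e.1 e.2).1
  choose q hq hqc using fun e : {a // a ∈ P} => (hBm (en e.1)).1 (hP1 e.1 e.2).2.2.1
  have hcfg : Config G c c' L p q (fun e => T e.1) (sg c (B : Set V)) (sg c' (A : Set V)) :=
    { hc := hc
      hc' := hc'
      hm := hmax
      hp := hp
      hq := hq
      pinj := by
        intro e f hef
        apply Subtype.ext
        rw [← hpc e, ← hpc f, hef]
      qinj := by
        intro e f hef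
        by_contra hne
        apply (hP2 e.1 e.2 f.1 f.2 (fun h => hne (Subtype.ext h))).1
        rw [← hqc e, ← hqc f, hef]
      Tc := by
        intro e
        rw [hAs]
        exact (hP1 e.1 e.2).2.2.2.2.1
      Tc' := by
        intro e
        rw [hBs]
        exact (hP1 e.1 e.2).2.2.2.2.2.1
      TT := fun e f hne => (hP2 e.1 e.2 f.1 f.2 (fun h => hne (Subtype.ext h))).2
      conn := by
        intro e
        rw [hpc, hqc]
        exact (hP1 e.1 e.2).2.2.2.2.2.2
      smono := sg_mono _ _
      smono' := sg_mono _ _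
      sep := by
        intro e f r h1 h2 h3
        rw [hBs]
        refine sg_sep h1 ?_ h2 h3
        rw [hpc]
        exact_mod_cast (hP1 e.1 e.2).2.1
      sep' := by
        intro e f r h1 h2 h3
        rw [hAs]
        refine sg_sep h1 ?_ h2 h3
        rw [hqc]
        exact_mod_cast (hP1 e.1 e.2).2.2.2.1 }
  have hcount := hcfg.count (m := (A ∩ B).card)
    (fun e => sg_le hc B (A ∩ B) _ (hp e) (fun r hr h =>
      Finset.mem_inter.2 ⟨(hAm _).2 ⟨r, hr, rfl⟩, h⟩))
    (fun e => sg_le hc' A (A ∩ B) _ (hq e) (fun r hr h =>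
      Finset.mem_inter.2 ⟨h, (hBm _).2 ⟨r, hr, rfl⟩⟩))
  rw [Fintype.card_coe] at hcount
  refine ⟨x, W, (A ∩ B).card, k, hW, ?_, by omega, P.card, hPk, hcount.1, hcount.2⟩
  rw [hWL, ← hAc]
  exact hg

end fin

lemma arith {d m k N : ℕ} (hd : 2 ≤ d) (h1 : d + 1 ≤ 2 * k) (h2 : k ≤ N + m)
    (h3 : N ^ 2 ≤ 10 * (m + 1) ^ 3) (h4 : N ≤ (m + 1) ^ 2) : d ^ 2 ≤ 400 * m ^ 3 := by
  have hm : 1 ≤ m := by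
    by_contra h
    have : m = 0 := by omega
    subst this
    simp at h4
    omega
  have h5 : N ^ 2 ≤ 80 * m ^ 3 := by
    have : (m + 1) ^ 3 ≤ (2 * m) ^ 3 := Nat.pow_le_pow_left (by omega) 3
    calc N ^ 2 ≤ 10 * (m + 1) ^ 3 := h3
      _ ≤ 10 * (2 * m) ^ 3 := by omega
      _ = 80 * m ^ 3 := by ring
  have h6 : m ^ 2 ≤ m ^ 3 := Nat.pow_le_pow_right hm (by norm_num)
  have h7 : d ≤ 2 * (N + m) := by omega
  have h8 : d ^ 2 ≤ (2 * (N + m)) ^ 2 := Nat.pow_le_pow_left h7 2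
  have h9 : 2 * (N * (9 * m)) ≤ N ^ 2 + 81 * m ^ 2 := by
    zify
    nlinarith [sq_nonneg ((N : ℤ) - 9 * m)]
  nlinarith

lemma arith_real {d m n L : ℕ} (h1 : d ^ 2 ≤ 400 * m ^ 3) (h2 : m * n ≤ L ^ 2) :
    (1 / 3 : ℝ) * (d : ℝ) ^ ((1 : ℝ) / 3) * (n : ℝ) ^ ((1 : ℝ) / 2) ≤ (L : ℝ) := by
  have hd : ((d : ℝ) ^ ((1 : ℝ) / 3)) ^ 6 = (d : ℝ) ^ 2 := by
    rw [← Real.rpow_natCast, ← Real.rpow_mul (by positivity), ← Real.rpow_natCast]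
    norm_num
  have hn : ((n : ℝ) ^ ((1 : ℝ) / 2)) ^ 6 = (n : ℝ) ^ 3 := by
    rw [← Real.rpow_natCast, ← Real.rpow_mul (by positivity), ← Real.rpow_natCast]
    norm_num
  refine le_of_pow_le_pow_left₀ (n := 6) (by norm_num) (by positivity) ?_
  rw [mul_pow, mul_pow, hd, hn]
  have h1' : (d : ℝ) ^ 2 ≤ 400 * (m : ℝ) ^ 3 := by exact_mod_cast h1
  have h2' : (m : ℝ) * n ≤ (L : ℝ) ^ 2 := by exact_mod_cast h2
  have h3 : ((m : ℝ) * n) ^ 3 ≤ ((L : ℝ) ^ 2) ^ 3 := pow_le_pow_left₀ (by positivity) h2' 3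
  calc (1 / 3 : ℝ) ^ 6 * (d : ℝ) ^ 2 * (n : ℝ) ^ 3
      ≤ (1 / 3 : ℝ) ^ 6 * (400 * (m : ℝ) ^ 3) * (n : ℝ) ^ 3 := by gcongr
    _ = (400 / 729) * ((m : ℝ) * n) ^ 3 := by ring
    _ ≤ 1 * ((m : ℝ) * n) ^ 3 := by gcongr; norm_num
    _ ≤ (L : ℝ) ^ 6 := by rw [one_mul]; calc _ ≤ _ := h3
                              _ = _ := by ring

end LC

theorem stmt_2 :
    ∃ c : ℝ, 0 < c ∧
      ∀ (n d : ℕ), d < n → 2 ≤ d →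
        ∀ (V : Type) [Fintype V] [DecidableEq V] (G : SimpleGraph V) [DecidableRel G.Adj],
          Fintype.card V = n → G.Connected → G.IsRegularOfDegree d → IsVertexTransitive G →
          ∃ (x : V) (W : G.Walk x x), W.IsCycle ∧
            c * (d : ℝ) ^ ((1 : ℝ) / 3) * (n : ℝ) ^ ((1 : ℝ) / 2) ≤ (W.length : ℝ) := by
  refine ⟨1 / 3, by norm_num, ?_⟩
  intro n d _ hd V _ _ G _ hn hconn hreg hvt
  obtain ⟨x, W, m, k, hW, h1, h2, N, h3, h4, h5⟩ := LC.main_comb hd hconn hreg hvt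
  rw [hn] at h1
  exact ⟨x, W, hW, LC.arith_real (LC.arith hd h2 h3 h4 h5) h1⟩
end
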